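/- arXiv:1801.06906 — 2 statements merged into one kernel-verified Lean document; each statement's English description precedes it below -/
import Mathlib

section
/- Let χ be a Dirichlet character mod q. The number N(T,χ) of zeros of L(s,χ) with 0 < Re(s) < 1 and |Im(s)| < T satisfies both N(T,χ) = O(T log(qT)) and N(T,χ) − N(T−1,χ) = O(log(qT)) for T ≥ 1. -/
open Complex

/-- `s - 1` times the error of the trapezoid rule for `u ↦ u ^ (-s)` on `[x, x + 1]`. -/
noncomputable def trapezoidError (x : ℝ) (s : ℂ) : ℂ :=
  (s - 1) * ((x : ℂ) ^ (-s) + (x + 1 : ℂ) ^ (-s)) / 2 - (x : ℂ) ^ (1 - s) + (x + 1 : ℂ) ^ (1 - s)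

theorem norm_trapezoidError_le {x : ℝ} (hx : 0 < x) {s : ℂ} (hs : -2 ≤ s.re) :
    ‖trapezoidError x s‖ ≤ ‖s - 1‖ * ‖s‖ * ‖s + 1‖ / 8 * x ^ (-(s.re + 2)) := by
  have hpow (c : ℂ) (u : ℝ) (hu : 0 ≤ u) :
      HasDerivAt (fun v : ℂ ↦ (x + v) ^ c) (c * (x + u) ^ (c - 1)) u := by
    have h := ((hasDerivAt_id (u : ℂ)).const_add (x : ℂ)).cpow_const (c := c)
      (Or.inl (by simp; linarith))
    simpa using h
  set K : ℂ → ℂ := fun v ↦ (s - 1) * (v * (1 - v) / 2 * (-s * (x + v) ^ (-s - 1)) -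
    (1 - 2 * v) / 2 * (x + v) ^ (-s)) + (x + v) ^ (1 - s) with hK
  have hderiv (u : ℝ) (hu : 0 ≤ u) : HasDerivAt K
      ((s - 1) * (u * (1 - u) / 2 * (s * (s + 1) * (x + u) ^ (-s - 2)))) u := by
    have hid := hasDerivAt_id (u : ℂ)
    have h1 : HasDerivAt (fun v : ℂ ↦ v * (1 - v) / 2) ((1 - 2 * u) / 2) u := by
      have := (hid.mul (hid.const_sub 1)).div_const 2
      refine this.congr_deriv ?_
      simp; ring
    have h2 : HasDerivAt (fun v : ℂ ↦ (1 - 2 * v) / 2) (-1) u := by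
      have := ((hid.const_mul 2).const_sub 1).div_const 2
      refine this.congr_deriv ?_
      simp
    have h := (((h1.mul ((hpow (-s - 1) u hu).const_mul (-s))).sub
      (h2.mul (hpow (-s) u hu))).const_mul (s - 1)).add (hpow (1 - s) u hu)
    refine h.congr_deriv ?_
    rw [show -s - 1 - 1 = -s - 2 by ring, show 1 - s - 1 = -s by ring]
    ring
  have key := norm_image_sub_le_of_norm_deriv_le_segment_01' (f := fun u : ℝ ↦ K u)
    (C := ‖s - 1‖ * ‖s‖ * ‖s + 1‖ / 8 * x ^ (-(s.re + 2)))
    (fun u hu ↦ (hderiv u hu.1).comp_ofReal.hasDerivWithinAt) ?_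
  · have h01 : trapezoidError x s = K (1 : ℝ) - K (0 : ℝ) := by
      simp [hK, trapezoidError]
      ring
    rwa [h01]
  · intro u hu
    have hu0 : 0 ≤ u := hu.1
    have hu1 : 0 ≤ 1 - u := by linarith [hu.2]
    have hn : ‖((x : ℂ) + u) ^ (-s - 2)‖ ≤ x ^ (-(s.re + 2)) := by
      rw [← ofReal_add, norm_cpow_eq_rpow_re_of_pos (by linarith)]
      have : (-s - 2).re = -(s.re + 2) := by simp; ring
      rw [this]
      exact Real.rpow_le_rpow_of_nonpos hx (by linarith) (by linarith)
    have hq : ‖(u : ℂ) * (1 - u) / 2‖ ≤ 1 / 8 := by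
      rw [show (u : ℂ) * (1 - u) / 2 = ((u * (1 - u) / 2 : ℝ) : ℂ) by push_cast; ring,
        Complex.norm_of_nonneg (by positivity)]
      nlinarith [sq_nonneg (u - 1 / 2)]
    calc _ = ‖s - 1‖ * ‖s‖ * ‖s + 1‖ *
        (‖(u : ℂ) * (1 - u) / 2‖ * ‖((x : ℂ) + u) ^ (-s - 2)‖) := by
          simp only [norm_mul]; ring
      _ ≤ ‖s - 1‖ * ‖s‖ * ‖s + 1‖ * (1 / 8 * x ^ (-(s.re + 2))) := by gcongr
      _ = _ := by ring

theorem rpow_natCast_add_le {a : ℝ} (ha : 0 < a) (ha1 : a ≤ 1) {σ B : ℝ} (h1 : -1 / 2 ≤ σ)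
    (h2 : σ ≤ B) (n : ℕ) :
    ((n : ℝ) + a) ^ (-(σ + 2)) ≤ a ^ (-(B + 2)) * ((n : ℝ) + 1) ^ (-(3 / 2 : ℝ)) := by
  have hn : (0 : ℝ) ≤ n := n.cast_nonneg
  calc ((n : ℝ) + a) ^ (-(σ + 2)) ≤ (a * ((n : ℝ) + 1)) ^ (-(σ + 2)) :=
        Real.rpow_le_rpow_of_nonpos (by positivity) (by nlinarith) (by linarith)
    _ = a ^ (-(σ + 2)) * ((n : ℝ) + 1) ^ (-(σ + 2)) := Real.mul_rpow ha.le (by positivity)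
    _ ≤ _ := by
      gcongr ?_ * ?_
      · exact Real.rpow_le_rpow_of_exponent_ge ha ha1 (by linarith)
      · exact Real.rpow_le_rpow_of_exponent_le (by linarith) (by linarith)

theorem summable_natCast_add_one_rpow :
    Summable fun n : ℕ ↦ ((n : ℝ) + 1) ^ (-(3 / 2 : ℝ)) := by
  have := (summable_nat_add_iff 1).mpr (Real.summable_nat_rpow (p := -(3 / 2)) |>.mpr (by norm_num))
  simpa using this

theorem norm_trapezoidError_natCast_add_le {a : ℝ} (ha : 0 < a) (ha1 : a ≤ 1) {s : ℂ} {B : ℝ}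
    (h1 : -1 / 2 ≤ s.re) (h2 : s.re ≤ B) (n : ℕ) :
    ‖trapezoidError (n + a) s‖ ≤ ‖s - 1‖ * ‖s‖ * ‖s + 1‖ / 8 *
      (a ^ (-(B + 2)) * ((n : ℝ) + 1) ^ (-(3 / 2 : ℝ))) := by
  refine (norm_trapezoidError_le (by positivity) (by linarith)).trans ?_
  gcongr
  exact rpow_natCast_add_le ha ha1 h1 h2 n

theorem summable_trapezoidError {a : ℝ} (ha : 0 < a) (ha1 : a ≤ 1) {s : ℂ}
    (h1 : -1 / 2 ≤ s.re) : Summable fun n : ℕ ↦ trapezoidError (n + a) s :=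
  .of_norm_bounded ((summable_natCast_add_one_rpow.mul_left _).mul_left _)
    (norm_trapezoidError_natCast_add_le ha ha1 h1 le_rfl)

/-- The Euler–Maclaurin expression for `(s - 1) ζ(s, a)`, valid for `-1 / 2 < re s`. -/
noncomputable def hurwitzEulerMaclaurin (a : ℝ) (s : ℂ) : ℂ :=
  (s - 1) * (a : ℂ) ^ (-s) / 2 + (a : ℂ) ^ (1 - s) + ∑' n : ℕ, trapezoidError (n + a) s

theorem differentiable_trapezoidError {x : ℝ} (hx : 0 < x) :
    Differentiable ℂ (trapezoidError x) := by
  have h1 : (x : ℂ) ≠ 0 := ofReal_ne_zero.mpr hx.ne'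
  have h2 : (x + 1 : ℂ) ≠ 0 := by exact_mod_cast (by linarith : x + 1 ≠ 0)
  intro s
  unfold trapezoidError
  have h (c : ℂ) (hc : c ≠ 0) : DifferentiableAt ℂ (fun s : ℂ ↦ c ^ (-s)) s :=
    (differentiableAt_id.neg).const_cpow (Or.inl hc)
  have h' (c : ℂ) (hc : c ≠ 0) : DifferentiableAt ℂ (fun s : ℂ ↦ c ^ (1 - s)) s :=
    (differentiableAt_id.const_sub 1).const_cpow (Or.inl hc)
  have := h _ h1
  have := h _ h2
  have := h' _ h1
  have := h' _ h2
  fun_prop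

theorem differentiableOn_hurwitzEulerMaclaurin {a : ℝ} (ha : 0 < a) (ha1 : a ≤ 1) :
    DifferentiableOn ℂ (hurwitzEulerMaclaurin a) {s | -1 / 2 < s.re} := by
  intro s hs
  have h0 : (a : ℂ) ≠ 0 := ofReal_ne_zero.mpr ha.ne'
  have h1 : DifferentiableAt ℂ (fun s : ℂ ↦ (a : ℂ) ^ (-s)) s :=
    (differentiableAt_id.neg).const_cpow (Or.inl h0)
  have h2 : DifferentiableAt ℂ (fun s : ℂ ↦ (a : ℂ) ^ (1 - s)) s :=
    (differentiableAt_id.const_sub 1).const_cpow (Or.inl h0)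
  have hopen : IsOpen ({s : ℂ | -1 / 2 < s.re} ∩ {z | ‖z‖ < ‖s‖ + 1}) :=
    (isOpen_lt continuous_const continuous_re).inter (isOpen_lt continuous_norm continuous_const)
  have h3 : DifferentiableAt ℂ (fun s ↦ ∑' n : ℕ, trapezoidError (n + a) s) s := by
    refine (differentiableOn_tsum_of_summable_norm (F := fun (n : ℕ) z ↦ trapezoidError (n + a) z)
      (u := fun n : ℕ ↦ (‖s‖ + 1 + 1) * (‖s‖ + 1) * (‖s‖ + 1 + 1) / 8 *
        (a ^ (-(‖s‖ + 1 + 2)) * ((n : ℝ) + 1) ^ (-(3 / 2 : ℝ))))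
      ((summable_natCast_add_one_rpow.mul_left _).mul_left _)
      (fun n ↦ (differentiable_trapezoidError (by positivity)).differentiableOn) hopen
      ?_).differentiableAt (hopen.mem_nhds ⟨hs, by simp⟩)
    rintro n w ⟨hw, hw' : ‖w‖ < ‖s‖ + 1⟩
    refine (norm_trapezoidError_natCast_add_le ha ha1 (le_of_lt hw)
      ((re_le_norm w).trans hw'.le) n).trans ?_
    gcongr
    · exact (norm_sub_le _ _).trans (by simpa using hw'.le)
    · exact (norm_add_le _ _).trans (by simpa using hw'.le)
  unfold hurwitzEulerMaclaurin
  exact DifferentiableAt.differentiableWithinAt (by fun_prop)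

theorem sum_range_trapezoidError (a : ℝ) (s : ℂ) (N : ℕ) :
    ∑ n ∈ Finset.range N, trapezoidError (n + a) s =
      (s - 1) * (∑ n ∈ Finset.range N, ((n : ℂ) + a) ^ (-s) + ((N : ℂ) + a) ^ (-s) / 2 -
        (a : ℂ) ^ (-s) / 2) + ((N : ℂ) + a) ^ (1 - s) - (a : ℂ) ^ (1 - s) := by
  induction N with
  | zero => simp
  | succ N ih =>
    rw [Finset.sum_range_succ, ih, Finset.sum_range_succ, trapezoidError]
    push_cast
    rw [show (N : ℂ) + a + 1 = N + 1 + a by ring]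
    ring

section

open HurwitzZeta Filter Topology

theorem hurwitzEulerMaclaurin_eq_of_one_lt_re {a : ℝ} (ha : 0 < a) (ha1 : a ≤ 1) {s : ℂ}
    (hs : 1 < s.re) :
    hurwitzEulerMaclaurin a s = (s - 1) * hurwitzZeta (a : UnitAddCircle) s := by
  have hz : HasSum (fun n : ℕ ↦ ((n : ℂ) + a) ^ (-s)) (hurwitzZeta (a : UnitAddCircle) s) := by
    simpa [cpow_neg] using hasSum_hurwitzZeta_of_one_lt_re ⟨ha.le, ha1⟩ hs
  have hw : Tendsto (fun N : ℕ ↦ ((N : ℂ) + a) ^ (1 - s)) atTop (𝓝 0) := by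
    rw [tendsto_zero_iff_norm_tendsto_zero]
    have h := (tendsto_rpow_neg_atTop (y := s.re - 1) (by linarith)).comp
      (tendsto_atTop_add_const_right atTop a tendsto_natCast_atTop_atTop)
    refine h.congr fun N ↦ ?_
    have : (N : ℂ) + a = ((N + a : ℝ) : ℂ) := by push_cast; rfl
    rw [this, norm_cpow_eq_rpow_re_of_pos (by positivity)]
    simp
  have hlim := (((((hz.tendsto_sum_nat.add (hz.summable.tendsto_atTop_zero.div_const 2)).sub
    (tendsto_const_nhds (x := (a : ℂ) ^ (-s) / 2))).const_mul (s - 1)).add hw).sub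
    (tendsto_const_nhds (x := (a : ℂ) ^ (1 - s))))
  have hsum := (summable_trapezoidError ha ha1 (s := s) (by linarith)).hasSum.tendsto_sum_nat
  simp only [sum_range_trapezoidError] at hsum
  rw [hurwitzEulerMaclaurin, tendsto_nhds_unique hsum hlim]
  ring

theorem hurwitzEulerMaclaurin_eq {a : ℝ} (ha : 0 < a) (ha1 : a ≤ 1) {s : ℂ}
    (hs : -1 / 2 < s.re) (hs1 : s ≠ 1) :
    hurwitzEulerMaclaurin a s = (s - 1) * hurwitzZeta (a : UnitAddCircle) s := by
  set F : ℂ → ℂ := Function.update (fun s ↦ (s - 1) * hurwitzZeta (a : UnitAddCircle) s) 1 1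
    with hF
  have hne (z : ℂ) (hz : z ≠ 1) : F z = (z - 1) * hurwitzZeta (a : UnitAddCircle) z := by
    simp [hF, hz]
  have hd (z : ℂ) (hz : z ≠ 1) : DifferentiableAt ℂ F z := by
    have h : DifferentiableAt ℂ (fun s ↦ (s - 1) * hurwitzZeta (a : UnitAddCircle) s) z :=
      (differentiableAt_id.sub_const 1).mul (differentiableAt_hurwitzZeta _ hz)
    refine h.congr_of_eventuallyEq ?_
    filter_upwards [isOpen_ne.mem_nhds hz] with w hw using hne w hw
  have hdiff : Differentiable ℂ F := by
    intro z
    rcases eq_or_ne z 1 with rfl | hz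
    · refine (analyticAt_of_differentiable_on_punctured_nhds_of_continuousAt ?_ ?_).differentiableAt
      · filter_upwards [self_mem_nhdsWithin] with w hw using hd w hw
      · exact continuousAt_update_same.mpr (hurwitzZeta_residue_one _)
    · exact hd z hz
  have hU : IsOpen {s : ℂ | -1 / 2 < s.re} := isOpen_lt continuous_const continuous_re
  have := ((differentiableOn_hurwitzEulerMaclaurin ha ha1).analyticOnNhd
    hU).eqOn_of_preconnected_of_eventuallyEq (hdiff.differentiableOn.analyticOnNhd hU)
    (convex_halfSpace_re_gt _).isPreconnected (z₀ := 2) (by simp; norm_num) ?_ hs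
  · rw [this, hne s hs1]
  · filter_upwards [(isOpen_lt continuous_const continuous_re).mem_nhds
      (show (1 : ℝ) < (2 : ℂ).re by simp)] with w hw
    rw [hurwitzEulerMaclaurin_eq_of_one_lt_re ha ha1 hw, hne w]
    rintro rfl
    simp at hw

theorem riemannZeta_ne_zero_of_abs_im_lt {s : ℂ} (h0 : 0 < s.re) (h1 : s.re < 1)
    (him : |s.im| < 11 / 10) : riemannZeta s ≠ 0 := by
  intro hz
  have hs1 : s ≠ 1 := by rintro rfl; simp at h1
  have hE := hurwitzEulerMaclaurin_eq one_pos le_rfl (s := s) (by linarith) hs1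
  rw [AddCircle.coe_period, hurwitzZeta_zero, hz, mul_zero, hurwitzEulerMaclaurin] at hE
  have hpi : Real.pi ^ 2 / 6 ≤ 5 / 3 := by
    have := Real.pi_lt_d2
    nlinarith [Real.pi_pos]
  have hsq : Summable fun n : ℕ ↦ 1 / ((n + 1 : ℕ) : ℝ) ^ 2 :=
    (summable_nat_add_iff 1).mpr hasSum_zeta_two.summable
  have hsum : ∑' n : ℕ, 1 / ((n + 1 : ℕ) : ℝ) ^ 2 = Real.pi ^ 2 / 6 := by
    rw [← hasSum_zeta_two.tsum_eq, hasSum_zeta_two.summable.tsum_eq_zero_add]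
    simp
  have hle : ‖∑' n : ℕ, trapezoidError (n + 1) s‖ ≤
      ‖s - 1‖ * ‖s‖ * ‖s + 1‖ / 8 * (Real.pi ^ 2 / 6) := by
    rw [← hsum, ← tsum_mul_left]
    refine tsum_of_norm_bounded (hsq.mul_left _).hasSum fun n ↦ ?_
    refine (norm_trapezoidError_le (by positivity) (by linarith)).trans ?_
    gcongr
    rw [one_div, ← Real.rpow_natCast, ← Real.rpow_neg (by positivity)]
    push_cast
    exact Real.rpow_le_rpow_of_exponent_le (by linarith [n.cast_nonneg (α := ℝ)]) (by linarith)
  have heq : ∑' n : ℕ, trapezoidError (n + 1) s = -((s + 1) / 2) := by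
    simp only [ofReal_one, one_cpow] at hE
    linear_combination hE
  rw [heq, norm_neg, norm_div] at hle
  have hpos : 0 < ‖s + 1‖ := norm_pos_iff.mpr fun h ↦ by
    have := congrArg re h
    simp at this
    linarith
  have ht : s.im ^ 2 ≤ 121 / 100 := by
    rw [← sq_abs]; nlinarith [abs_nonneg s.im]
  have hA : ‖s - 1‖ ^ 2 ≤ 221 / 100 := by
    rw [← normSq_eq_norm_sq, normSq_apply]; simp; nlinarith
  have hB : ‖s‖ ^ 2 ≤ 221 / 100 := by
    rw [← normSq_eq_norm_sq, normSq_apply]; nlinarith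
  have hAB : ‖s - 1‖ * ‖s‖ ≤ 221 / 100 := by nlinarith [sq_nonneg (‖s - 1‖ - ‖s‖)]
  have : ‖s - 1‖ * ‖s‖ * ‖s + 1‖ / 8 * (Real.pi ^ 2 / 6) ≤
      221 / 100 * ‖s + 1‖ / 8 * (5 / 3) := by gcongr
  norm_num at hle
  linarith

end

/-- The representative in `(0, 1]` of `j / q` modulo `1`. -/
noncomputable def residueFraction {q : ℕ} (j : ZMod q) : ℝ :=
  if j = 0 then 1 else j.val / q

section residueFraction

variable {q : ℕ} [NeZero q] (j : ZMod q)

theorem inv_le_residueFraction : (q : ℝ)⁻¹ ≤ residueFraction j := by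
  have hq : (1 : ℝ) ≤ q := by exact_mod_cast NeZero.one_le
  unfold residueFraction
  split_ifs with h
  · exact inv_le_one_of_one_le₀ hq
  · rw [inv_eq_one_div]
    gcongr
    exact_mod_cast Nat.one_le_iff_ne_zero.mpr ((ZMod.val_ne_zero j).mpr h)

theorem residueFraction_pos : 0 < residueFraction j :=
  (inv_pos.mpr (Nat.cast_pos.mpr (NeZero.pos q))).trans_le (inv_le_residueFraction j)

theorem residueFraction_le_one : residueFraction j ≤ 1 := by
  unfold residueFraction
  split_ifs
  · rfl
  · exact div_le_one_of_le₀ (by exact_mod_cast (ZMod.val_lt j).le) (by positivity)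

theorem coe_residueFraction : (residueFraction j : UnitAddCircle) = ZMod.toAddCircle j := by
  unfold residueFraction
  split_ifs with h
  · simp [h, AddCircle.coe_period]
  · rw [ZMod.toAddCircle_apply]

end residueFraction

/-- The Euler–Maclaurin expression for `(s - 1) L(s, χ)`, valid for `-1 / 2 < re s`. -/
noncomputable def lEulerMaclaurin {q : ℕ} [NeZero q] (χ : DirichletCharacter ℂ q) (s : ℂ) : ℂ :=
  (q : ℂ) ^ (-s) * ∑ j : ZMod q, χ j * hurwitzEulerMaclaurin (residueFraction j) s

section lEulerMaclaurin

variable {q : ℕ} [NeZero q] (χ : DirichletCharacter ℂ q)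

theorem lEulerMaclaurin_eq {s : ℂ} (hs : -1 / 2 < s.re) (hs1 : s ≠ 1) :
    lEulerMaclaurin χ s = (s - 1) * DirichletCharacter.LFunction χ s := by
  rw [lEulerMaclaurin, DirichletCharacter.LFunction, ZMod.LFunction, mul_left_comm,
    Finset.mul_sum _ _ (s - 1)]
  congr 1
  refine Finset.sum_congr rfl fun j _ ↦ ?_
  rw [hurwitzEulerMaclaurin_eq (residueFraction_pos j) (residueFraction_le_one j) hs hs1,
    coe_residueFraction]
  ring

theorem analyticOnNhd_lEulerMaclaurin :
    AnalyticOnNhd ℂ (lEulerMaclaurin χ) {s | -1 / 2 < s.re} := by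
  refine DifferentiableOn.analyticOnNhd ?_ (isOpen_lt continuous_const continuous_re)
  have hq : (q : ℂ) ≠ 0 := NeZero.ne _
  unfold lEulerMaclaurin
  refine DifferentiableOn.mul (fun s _ ↦ ?_) (DifferentiableOn.fun_sum fun j _ ↦
    (differentiableOn_hurwitzEulerMaclaurin (residueFraction_pos j)
      (residueFraction_le_one j)).const_mul _)
  exact ((differentiableAt_id.neg).const_cpow (Or.inl hq)).differentiableWithinAt

theorem norm_hurwitzEulerMaclaurin_le {a : ℝ} (ha : 0 < a) (ha1 : a ≤ 1) {s : ℂ}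
    (h1 : -1 / 2 ≤ s.re) (h2 : s.re ≤ 5) :
    ‖hurwitzEulerMaclaurin a s‖ ≤ a ^ (-7 : ℝ) *
      ((2 + ∑' n : ℕ, ((n : ℝ) + 1) ^ (-(3 / 2 : ℝ))) * (‖s‖ + 1) ^ 3) := by
  set S := ∑' n : ℕ, ((n : ℝ) + 1) ^ (-(3 / 2 : ℝ))
  have hS : 0 ≤ S := tsum_nonneg fun n ↦ by positivity
  have e1 : ‖s - 1‖ ≤ ‖s‖ + 1 := by simpa using norm_sub_le s 1
  have e2 : ‖s + 1‖ ≤ ‖s‖ + 1 := by simpa using norm_add_le s 1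
  have hsum : ‖∑' n : ℕ, trapezoidError (n + a) s‖ ≤
      ‖s - 1‖ * ‖s‖ * ‖s + 1‖ / 8 * (a ^ (-(5 + 2) : ℝ) * S) :=
    tsum_of_norm_bounded ((summable_natCast_add_one_rpow.hasSum.mul_left _).mul_left _)
      (norm_trapezoidError_natCast_add_le ha ha1 h1 h2)
  have hp (c : ℂ) (hc : -7 ≤ c.re) : ‖(a : ℂ) ^ c‖ ≤ a ^ (-7 : ℝ) := by
    rw [norm_cpow_eq_rpow_re_of_pos ha]
    exact Real.rpow_le_rpow_of_exponent_ge ha ha1 hc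
  have hY : 1 ≤ ‖s‖ + 1 := by linarith [norm_nonneg s]
  have hY3 : ‖s‖ + 1 ≤ (‖s‖ + 1) ^ 3 := le_self_pow₀ hY (by norm_num)
  have ha7 : 0 ≤ a ^ (-7 : ℝ) := by positivity
  calc ‖hurwitzEulerMaclaurin a s‖
      ≤ ‖s - 1‖ * ‖(a : ℂ) ^ (-s)‖ / 2 + ‖(a : ℂ) ^ (1 - s)‖ +
        ‖∑' n : ℕ, trapezoidError (n + a) s‖ := by
        refine (norm_add₃_le).trans ?_
        simp
    _ ≤ (‖s‖ + 1) * a ^ (-7 : ℝ) / 2 + a ^ (-7 : ℝ) +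
        (‖s‖ + 1) * (‖s‖ + 1) * (‖s‖ + 1) / 8 * (a ^ (-7 : ℝ) * S) := by
        rw [show (-(5 + 2) : ℝ) = -7 by norm_num] at hsum
        have := hp (-s) (by simp; linarith)
        have := hp (1 - s) (by simp; linarith)
        refine add_le_add (add_le_add (by gcongr) this) (hsum.trans ?_)
        gcongr
        linarith
    _ = a ^ (-7 : ℝ) * ((‖s‖ + 1) / 2 + 1 + S * (‖s‖ + 1) ^ 3 / 8) := by ring
    _ ≤ _ := by
        gcongr
        nlinarith [mul_nonneg hS (pow_nonneg (zero_le_one.trans hY) 3)]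

theorem norm_lEulerMaclaurin_le {s : ℂ} (h1 : -1 / 2 ≤ s.re) (h2 : s.re ≤ 5) :
    ‖lEulerMaclaurin χ s‖ ≤ (q : ℝ) ^ 9 *
      ((2 + ∑' n : ℕ, ((n : ℝ) + 1) ^ (-(3 / 2 : ℝ))) * (‖s‖ + 1) ^ 3) := by
  have hq : (1 : ℝ) ≤ q := by exact_mod_cast NeZero.one_le
  have hq0 : (0 : ℝ) < q := by linarith
  have hS : 0 ≤ ∑' n : ℕ, ((n : ℝ) + 1) ^ (-(3 / 2 : ℝ)) := tsum_nonneg fun n ↦ by positivity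
  set M := (2 + ∑' n : ℕ, ((n : ℝ) + 1) ^ (-(3 / 2 : ℝ))) * (‖s‖ + 1) ^ 3
  have hM : 0 ≤ M := by positivity
  have hpow : ‖(q : ℂ) ^ (-s)‖ ≤ q := by
    rw [← ofReal_natCast, norm_cpow_eq_rpow_re_of_pos hq0]
    calc (q : ℝ) ^ (-s).re ≤ (q : ℝ) ^ (1 : ℝ) :=
          Real.rpow_le_rpow_of_exponent_le hq (by simp; linarith)
      _ = q := Real.rpow_one _
  have hterm (j : ZMod q) : ‖χ j * hurwitzEulerMaclaurin (residueFraction j) s‖ ≤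
      (q : ℝ) ^ 7 * M := by
    rw [norm_mul]
    have h7 : residueFraction j ^ (-7 : ℝ) ≤ (q : ℝ) ^ 7 := by
      calc residueFraction j ^ (-7 : ℝ) ≤ ((q : ℝ)⁻¹) ^ (-7 : ℝ) :=
            Real.rpow_le_rpow_of_nonpos (by positivity) (inv_le_residueFraction j) (by norm_num)
        _ = (q : ℝ) ^ 7 := by
            rw [Real.inv_rpow hq0.le, Real.rpow_neg hq0.le, inv_inv]
            exact_mod_cast Real.rpow_natCast (q : ℝ) 7
    calc _ ≤ 1 * (residueFraction j ^ (-7 : ℝ) * M) := by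
          gcongr
          · exact χ.norm_le_one j
          · exact norm_hurwitzEulerMaclaurin_le (residueFraction_pos j)
              (residueFraction_le_one j) h1 h2
      _ ≤ _ := by rw [one_mul]; gcongr
  calc ‖lEulerMaclaurin χ s‖ ≤ q * ∑ _j : ZMod q, (q : ℝ) ^ 7 * M := by
        rw [lEulerMaclaurin, norm_mul]
        gcongr
        exact norm_sum_le_of_le _ fun j _ ↦ hterm j
    _ = _ := by
        simp [ZMod.card]
        ring

theorem one_third_le_norm_LFunction {s : ℂ} (hs : s.re = 2) :
    1 / 3 ≤ ‖DirichletCharacter.LFunction χ s‖ := by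
  have hs1 : 1 < s.re := by linarith
  have hsum : HasSum (LSeries.term (χ ·) s) (DirichletCharacter.LFunction χ s) := by
    rw [DirichletCharacter.LFunction_eq_LSeries χ hs1]
    exact (ZMod.LSeriesSummable_of_one_lt_re χ hs1).hasSum
  have hnorm (n : ℕ) : ‖LSeries.term (χ ·) s n‖ ≤ 1 / (n : ℝ) ^ 2 := by
    rw [LSeries.norm_term_eq]
    split_ifs with h
    · simp [h]
    · rw [hs, Real.rpow_two]
      gcongr
      exact χ.norm_le_one _
  have hpi : Real.pi ^ 2 / 6 ≤ 5 / 3 := by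
    have := Real.pi_lt_d2
    nlinarith [Real.pi_pos]
  have htail := (hasSum_nat_add_iff' 2).mpr hsum
  have htail' := (hasSum_nat_add_iff' 2).mpr hasSum_zeta_two
  have hle := htail.norm_le_of_bounded htail' fun n ↦ hnorm (n + 2)
  simp only [Finset.sum_range_succ, Finset.sum_range_zero, LSeries.term_zero, zero_add] at hle
  have h1 : LSeries.term (χ ·) s 1 = 1 := by simp [LSeries.term]
  rw [h1] at hle
  have := norm_sub_norm_le (1 : ℂ) (1 - DirichletCharacter.LFunction χ s)
  rw [norm_sub_rev] at hle
  norm_num at hle this ⊢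
  linarith

end lEulerMaclaurin

/-- If all finite subsets of `S` have at most `B` elements, then so does `S`. -/
theorem Set.finite_and_ncard_le_of_forall_finset {α : Type*} {S : Set α} {B : ℝ}
    (h : ∀ F : Finset α, (F : Set α) ⊆ S → (F.card : ℝ) ≤ B) : S.Finite ∧ (S.ncard : ℝ) ≤ B := by
  have hfin : S.Finite := by
    by_contra hinf
    obtain ⟨F, hF, hcard⟩ := Set.Infinite.exists_subset_card_eq hinf (⌊B⌋₊ + 1)
    have := h F hF
    rw [hcard] at this
    exact absurd this (not_le.mpr (by exact_mod_cast Nat.lt_floor_add_one B))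
  refine ⟨hfin, ?_⟩
  rw [Set.ncard_eq_toFinset_card S hfin]
  exact h _ (by simp)

/-- Jensen's inequality, counting distinct zeros. -/
theorem card_zeros_le {c : ℂ} {r R M : ℝ} {f : ℂ → ℂ} (hr : 0 < r) (hrR : r < R) (hM : 1 ≤ M)
    (hf : AnalyticOnNhd ℂ f (Metric.closedBall c R)) (hc : f c ≠ 0)
    (hfM : ∀ z ∈ Metric.sphere c R, ‖f z‖ ≤ M) (F : Finset ℂ)
    (hF : ∀ z ∈ F, z ∈ Metric.closedBall c r ∧ f z = 0) :
    (F.card : ℝ) ≤ Real.log (M / ‖f c‖) / Real.log (R / r) := by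
  have hR : 0 < R := hr.trans hrR
  have key := AnalyticOnNhd.sum_divisor_le (c := c) (r := r) (R := R) (f := f)
    (by simpa using hr.ne') (by rwa [abs_of_pos hr, abs_of_pos hR]) hM
    (by rwa [abs_of_pos hR]) hc (by rwa [abs_of_pos hR])
  rw [abs_of_pos hr] at key
  refine le_trans ?_ key
  have hf' : AnalyticOnNhd ℂ f (Metric.closedBall c r) :=
    hf.mono (Metric.closedBall_subset_closedBall hrR.le)
  set D := MeromorphicOn.divisor f (Metric.closedBall c r)
  have hDfin : (Function.support D).Finite := D.finiteSupport (isCompact_closedBall c r)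
  have hnonneg (z : ℂ) : 0 ≤ D z := MeromorphicOn.AnalyticOnNhd.divisor_nonneg hf' z
  have hone (z : ℂ) (hz : z ∈ F) : 1 ≤ D z := by
    obtain ⟨hzr, hz0⟩ := hF z hz
    have htop : analyticOrderAt f z ≠ ⊤ := by
      intro htop
      refine hc (hf'.eqOn_zero_of_preconnected_of_eventuallyEq_zero
        (convex_closedBall c r).isPreconnected hzr (analyticOrderAt_eq_top.mp htop) ?_)
      exact Metric.mem_closedBall_self hr.le
    have h0 : analyticOrderAt f z ≠ 0 := (hf' z hzr).analyticOrderAt_ne_zero.mpr hz0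
    rw [MeromorphicOn.AnalyticOnNhd.divisor_apply hf' hzr]
    obtain ⟨n, hn⟩ := ENat.ne_top_iff_exists.mp htop
    rw [← hn] at h0 ⊢
    have : n ≠ 0 := by simpa using h0
    simp
    omega
  have hsub : F ⊆ hDfin.toFinset := fun z hz ↦ by
    have := hone z hz
    simp only [Set.Finite.mem_toFinset, Function.mem_support]
    omega
  rw [finsum_eq_sum_of_support_subset D (s := hDfin.toFinset) (by simp)]
  have : (F.card : ℤ) ≤ ∑ z ∈ hDfin.toFinset, D z := by
    calc (F.card : ℤ) = ∑ z ∈ F, 1 := by simp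
      _ ≤ ∑ z ∈ F, D z := Finset.sum_le_sum hone
      _ ≤ _ := Finset.sum_le_sum_of_subset_of_nonneg hsub fun z _ _ ↦ hnonneg z
  exact_mod_cast this

theorem exists_card_window_le : ∃ A : ℝ, 0 < A ∧ ∀ (q : ℕ) (_ : NeZero q)
    (χ : DirichletCharacter ℂ q) (T : ℝ), 1 ≤ T → 11 / 10 ≤ q * T → ∀ n : ℤ, |(n : ℝ)| ≤ T + 1 →
    ∀ F : Finset ℂ, (∀ s ∈ F, DirichletCharacter.LFunction χ s = 0 ∧ 0 < s.re ∧ s.re < 1 ∧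
      ⌊s.im⌋ = n) → (F.card : ℝ) ≤ A * Real.log (q * T) := by
  set S := ∑' n : ℕ, ((n : ℝ) + 1) ^ (-(3 / 2 : ℝ))
  have hS : 0 ≤ S := tsum_nonneg fun n ↦ by positivity
  have hl : 0 < Real.log (11 / 10) := Real.log_pos (by norm_num)
  have hl' : 0 < Real.log ((12 / 5) / (21 / 10)) := Real.log_pos (by norm_num)
  set K : ℝ := 3 * (2 + S) * 8 ^ 3
  have hK : 0 < Real.log K := Real.log_pos (by simp only [K]; linarith)
  refine ⟨(9 + Real.log K / Real.log (11 / 10)) / Real.log ((12 / 5) / (21 / 10)),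
    by positivity, ?_⟩
  intro q _ χ T hT hqT n hn F hF
  have hq : (1 : ℝ) ≤ q := by exact_mod_cast NeZero.one_le
  set c : ℂ := ⟨2, n + 1 / 2⟩ with hcdef
  have hre (R : ℝ) (z : ℂ) (hz : z ∈ Metric.closedBall c R) : 2 - R ≤ z.re ∧ z.re ≤ 2 + R := by
    rw [mem_closedBall_iff_norm] at hz
    have := abs_le.mp ((abs_re_le_norm (z - c)).trans hz)
    simp only [sub_re, hcdef] at this
    constructor <;> linarith
  have hc1 : c ≠ 1 := fun h ↦ by simpa [hcdef] using congrArg re h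
  have hfc : 1 / 3 ≤ ‖lEulerMaclaurin χ c‖ := by
    rw [lEulerMaclaurin_eq χ (by simp [hcdef]; norm_num) hc1, norm_mul]
    have h1 : 1 ≤ ‖c - 1‖ := by
      refine le_trans ?_ (re_le_norm _)
      simp [hcdef]
      norm_num
    nlinarith [one_third_le_norm_LFunction χ (s := c) rfl]
  have hnc : ‖c‖ ≤ T + 7 / 2 := by
    refine (norm_le_abs_re_add_abs_im c).trans ?_
    have := abs_add_le (n : ℝ) (1 / 2)
    norm_num [hcdef] at this ⊢
    linarith
  set M : ℝ := (q : ℝ) ^ 9 * ((2 + S) * (8 * T) ^ 3)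
  have hM : 1 ≤ M := by
    refine one_le_mul_of_one_le_of_one_le (one_le_pow₀ hq)
      (one_le_mul_of_one_le_of_one_le (by linarith) (one_le_pow₀ (by linarith)))
  have hcard := card_zeros_le (c := c) (r := 21 / 10) (R := 12 / 5) (f := lEulerMaclaurin χ)
    (by norm_num) (by norm_num) hM
    ((analyticOnNhd_lEulerMaclaurin χ).mono fun z hz ↦ by
      have := (hre _ z hz).1
      simp only [Set.mem_ofPred_eq]
      linarith)
    (norm_pos_iff.mp (by linarith)) ?_ F ?_
  · refine hcard.trans ?_
    rw [div_mul_eq_mul_div]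
    gcongr
    have hlog : Real.log (11 / 10) ≤ Real.log (q * T) := Real.log_le_log (by norm_num) hqT
    calc Real.log (M / ‖lEulerMaclaurin χ c‖) ≤ Real.log (K * (q * T) ^ 9) := by
          refine Real.log_le_log (by positivity) ?_
          rw [div_le_iff₀ (by linarith)]
          have hT3 : T ^ 3 ≤ T ^ 9 := pow_le_pow_right₀ hT (by norm_num)
          calc M = (2 + S) * 8 ^ 3 * (q ^ 9 * T ^ 3) := by simp only [M]; ring
            _ ≤ (2 + S) * 8 ^ 3 * (q ^ 9 * T ^ 9) := by gcongr
            _ = K * (q * T) ^ 9 * (1 / 3) := by simp only [K]; ring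
            _ ≤ _ := by gcongr
      _ = Real.log K + 9 * Real.log (q * T) := by
          rw [Real.log_mul (by positivity) (by positivity), Real.log_pow]
          norm_num
      _ ≤ Real.log K * (Real.log (q * T) / Real.log (11 / 10)) + 9 * Real.log (q * T) := by
          gcongr
          exact le_mul_of_one_le_right hK.le ((one_le_div hl).mpr hlog)
      _ = _ := by ring
  · intro z hz
    obtain ⟨h1, h2⟩ := hre _ z (Metric.sphere_subset_closedBall hz)
    refine (norm_lEulerMaclaurin_le χ (by linarith) (by linarith)).trans ?_
    have : ‖z‖ ≤ ‖c‖ + 12 / 5 := by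
      rw [mem_sphere_iff_norm] at hz
      rw [← hz]
      exact (norm_le_norm_add_norm_sub' z c)
    simp only [M]
    gcongr
    linarith
  · intro z hz
    obtain ⟨hz0, hz1, hz2, hz3⟩ := hF z hz
    have hf1 := Int.floor_le z.im
    have hf2 := Int.lt_floor_add_one z.im
    rw [hz3] at hf1 hf2
    constructor
    · rw [mem_closedBall_iff_norm]
      refine abs_le_of_sq_le_sq' ?_ (by norm_num) |>.2
      rw [← normSq_eq_norm_sq, normSq_apply]
      simp only [sub_re, sub_im, hcdef]
      nlinarith
    · rw [lEulerMaclaurin_eq χ (by linarith) (by rintro rfl; simp at hz2), hz0, mul_zero]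

theorem setOf_zeros_eq_empty {q : ℕ} [NeZero q] (χ : DirichletCharacter ℂ q) {T : ℝ}
    (hT : 1 ≤ T) (hqT : q * T < 11 / 10) :
    {s : ℂ | DirichletCharacter.LFunction χ s = 0 ∧ 0 < s.re ∧ s.re < 1 ∧ |s.im| < T} = ∅ := by
  have hq0 : 1 ≤ q := NeZero.one_le
  have hq : q = 1 := by
    by_contra h
    have : (2 : ℝ) ≤ q := by exact_mod_cast (by omega : 2 ≤ q)
    nlinarith
  subst hq
  rw [DirichletCharacter.LFunction_modOne_eq, Set.eq_empty_iff_forall_notMem]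
  rintro s ⟨h0, h1, h2, h3⟩
  refine riemannZeta_ne_zero_of_abs_im_lt h1 h2 ?_ h0
  norm_num at hqT
  linarith

/-- Zero-counting bounds for Dirichlet `L`-functions: with
`N(T,χ) = #{ρ : L(ρ,χ) = 0, 0 < Re ρ < 1, |Im ρ| < T}`, one has
`N(T,χ) = O(T log(qT))` and `N(T,χ) − N(T−1,χ) = O(log(qT))` for `T ≥ 1`. -/
theorem dirichlet_zero_counting :
    ∃ C : ℝ, 0 < C ∧ ∀ (q : ℕ) (_ : NeZero q) (χ : DirichletCharacter ℂ q) (T : ℝ),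
      1 ≤ T →
      ((({s : ℂ | DirichletCharacter.LFunction χ s = 0 ∧ 0 < s.re ∧ s.re < 1 ∧
          |s.im| < T}).ncard : ℝ) ≤ C * T * Real.log (q * T) ∧
       (({s : ℂ | DirichletCharacter.LFunction χ s = 0 ∧ 0 < s.re ∧ s.re < 1 ∧
          |s.im| < T}).ncard : ℝ) -
        (({s : ℂ | DirichletCharacter.LFunction χ s = 0 ∧ 0 < s.re ∧ s.re < 1 ∧
          |s.im| < T - 1}).ncard : ℝ) ≤ C * Real.log (q * T)) := by
  obtain ⟨A, hA, hwin⟩ := exists_card_window_le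
  refine ⟨4 * A, by positivity, fun q hq χ T hT ↦ ?_⟩
  rcases lt_or_ge ((q : ℝ) * T) (11 / 10) with hqT | hqT
  · have hlog : 0 ≤ Real.log (q * T) := by
      refine Real.log_nonneg ?_
      have : (1 : ℝ) ≤ q := by exact_mod_cast NeZero.one_le
      nlinarith
    rw [setOf_zeros_eq_empty χ hT hqT, Set.ncard_empty, Nat.cast_zero]
    exact ⟨by positivity, (sub_nonpos.mpr (Nat.cast_nonneg _)).trans (by positivity)⟩
  set L := Real.log (q * T)
  have hL : 0 ≤ L := Real.log_nonneg (by linarith)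
  set Z : ℝ → Set ℂ := fun T ↦ {s : ℂ | DirichletCharacter.LFunction χ s = 0 ∧ 0 < s.re ∧
    s.re < 1 ∧ |s.im| < T}
  have hcover (F : Finset ℂ) (hF : (F : Set ℂ) ⊆ Z T) (t : Finset ℤ)
      (ht : ∀ s ∈ F, ⌊s.im⌋ ∈ t) : (F.card : ℝ) ≤ A * L * t.card := by
    rw [Finset.card_eq_sum_card_fiberwise ht, Nat.cast_sum, mul_comm, ← nsmul_eq_mul]
    refine Finset.sum_le_card_nsmul _ _ _ fun n _ ↦ ?_
    rcases (F.filter fun s ↦ ⌊s.im⌋ = n).eq_empty_or_nonempty with he | ⟨s, hs⟩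
    · rw [he, Finset.card_empty, Nat.cast_zero]
      positivity
    · refine hwin q hq χ T hT hqT n ?_ _ fun w hw ↦ ?_
      · obtain ⟨hsF, rfl⟩ := Finset.mem_filter.mp hs
        have hsT := abs_lt.mp (hF hsF).2.2.2
        rw [abs_le]
        constructor <;> linarith [Int.floor_le s.im, Int.lt_floor_add_one s.im]
      · obtain ⟨hwF, hwn⟩ := Finset.mem_filter.mp hw
        exact ⟨(hF hwF).1, (hF hwF).2.1, (hF hwF).2.2.1, hwn⟩
  have hZ := Set.finite_and_ncard_le_of_forall_finset (S := Z T) (B := 4 * A * T * L)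
    fun F hF ↦ by
      refine (hcover F hF (Finset.Icc ⌊-T⌋ ⌊T⌋) fun s hs ↦ ?_).trans ?_
      · have hsT := abs_lt.mp (hF hs).2.2.2
        exact Finset.mem_Icc.mpr ⟨Int.floor_le_floor hsT.1.le, Int.floor_le_floor hsT.2.le⟩
      · have hle : ⌊-T⌋ ≤ ⌊T⌋ := Int.floor_le_floor (by linarith)
        have hcard : ((Finset.Icc ⌊-T⌋ ⌊T⌋).card : ℝ) ≤ 4 * T := by
          rw [Int.card_Icc, ← Int.cast_natCast, Int.toNat_of_nonneg (by omega)]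
          push_cast
          linarith [Int.floor_le T, Int.lt_floor_add_one (-T)]
        calc _ ≤ A * L * (4 * T) := by gcongr
          _ = _ := by ring
  refine ⟨hZ.2, ?_⟩
  have hdiff := Set.finite_and_ncard_le_of_forall_finset (S := Z T \ Z (T - 1)) (B := 4 * A * L)
    fun F hF ↦ by
      refine (hcover F (fun s hs ↦ (hF hs).1)
        (Finset.Icc ⌊-T⌋ (⌊-T⌋ + 1) ∪ Finset.Icc (⌊T⌋ - 1) ⌊T⌋) fun s hs ↦ ?_).trans ?_
      · obtain ⟨⟨h0, h1, h2, h3⟩, hnot⟩ := hF hs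
        have him : T - 1 ≤ |s.im| := by
          by_contra! h
          exact hnot ⟨h0, h1, h2, h⟩
        have hsT := abs_lt.mp h3
        rw [Finset.mem_union, Finset.mem_Icc, Finset.mem_Icc]
        rcases le_abs.mp him with h | h
        · right
          rw [← Int.floor_sub_one]
          exact ⟨Int.floor_le_floor h, Int.floor_le_floor hsT.2.le⟩
        · left
          rw [← Int.floor_add_one]
          exact ⟨Int.floor_le_floor hsT.1.le, Int.floor_le_floor (by linarith)⟩
      · have hcard : (Finset.Icc ⌊-T⌋ (⌊-T⌋ + 1) ∪ Finset.Icc (⌊T⌋ - 1) ⌊T⌋).card ≤ 4 := by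
          refine (Finset.card_union_le _ _).trans ?_
          simp only [Int.card_Icc]
          omega
        calc _ ≤ A * L * 4 := by gcongr; exact_mod_cast hcard
          _ = _ := by ring
  have hsub : Z (T - 1) ⊆ Z T := fun s hs ↦ ⟨hs.1, hs.2.1, hs.2.2.1, by linarith [hs.2.2.2]⟩
  have hle := Set.ncard_le_ncard_sdiff_add_ncard (Z T) (Z (T - 1)) (hZ.1.subset hsub)
  have hle' : ((Z T).ncard : ℝ) ≤ (Z T \ Z (T - 1)).ncard + (Z (T - 1)).ncard := by
    exact_mod_cast hle
  linarith [hdiff.2]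
end

section
/- Assume GRH for L(s,χ) and L(1/2,χ) ≠ 0 for a non-principal character χ mod q. For fixed T₀ ≥ 2, define S(x,T₀;χ) = ∑_{T₀ < |γ| ≤ T(x)} L'(ρ,χ)x^{iγ}/(1/2+iγ), summing over nontrivial zeros ρ = 1/2+iγ, where T(x) is any function with x^{2/3}/2 ≤ T(x) ≤ 2x^{5/6}. Then for every ε > 0, ∫_2^Y |S(e^y,T₀;χ)|² dy ≪_ε Y/T₀^{1−ε} + (log Y)/T₀^{1−ε} + T₀^ε. -/
open Complex MeasureTheory

open Finset in
/-- Partial sums of a non-principal Dirichlet character mod `q` are bounded by `q`. -/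
theorem DirichletCharacter.norm_sum_range_le {q : ℕ} [NeZero q] {χ : DirichletCharacter ℂ q}
    (hχ : χ ≠ 1) (n : ℕ) : ‖∑ k ∈ range n, χ k‖ ≤ q := by
  induction n using Nat.strong_induction_on with
  | _ n ih =>
    rcases lt_or_ge n q with h | h
    · refine (norm_sum_le_of_le (range n) (n := 1) fun k _ ↦ χ.norm_le_one k).trans ?_
      simpa using h.le
    · obtain ⟨m, rfl⟩ := Nat.exists_eq_add_of_le h
      have hq : 0 < q := NeZero.pos q
      have hfull : ∑ k ∈ range q, χ (k : ZMod q) = 0 := by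
        rw [← MulChar.sum_eq_zero_of_ne_one hχ]
        refine sum_nbij' (fun k ↦ (k : ZMod q)) ZMod.val (by simp) (by simp [ZMod.val_lt])
          (fun k hk ↦ ZMod.val_cast_of_lt (mem_range.mp hk)) (by simp) (by simp)
      rw [sum_range_add, hfull, zero_add]
      simpa using ih m (by omega)

/-- A non-principal Dirichlet `L`-function grows at most linearly in `re s ≥ 1 / 4`. -/
theorem DirichletCharacter.exists_norm_LFunction_le {q : ℕ} [NeZero q]
    {χ : DirichletCharacter ℂ q} (hχ : χ ≠ 1) :
    ∃ C : ℝ, 1 ≤ C ∧ ∀ s : ℂ, 1 / 4 ≤ s.re → ‖LFunction χ s‖ ≤ C * ‖s‖ := by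
  set S : ℝ → ℂ := fun t ↦ ∑ k ∈ Finset.Icc 1 ⌊t⌋₊, χ (k : ZMod q) with hS
  have hSle (t : ℝ) : ‖S t‖ ≤ 1 + q := by
    have h : ∑ k ∈ Finset.range (⌊t⌋₊ + 1), χ (k : ZMod q) = S t + χ 0 := by
      rw [Finset.sum_range_eq_add_Ico _ (by omega), add_comm]
      simp [hS, Finset.Ico_add_one_right_eq_Icc]
    rw [eq_sub_of_add_eq h.symm]
    refine (norm_sub_le _ _).trans ?_
    linarith [norm_sum_range_le hχ (⌊t⌋₊ + 1), χ.norm_le_one 0]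
  have hS0 (t : ℝ) (ht : t < 1) : S t = 0 := by
    simp [hS, Nat.floor_eq_zero.mpr ht]
  have hSm : Measurable S := by
    have : Measurable (fun n : ℕ ↦ ∑ k ∈ Finset.Icc 1 n, χ (k : ZMod q)) := measurable_from_top
    exact this.comp Nat.measurable_floor
  have hloc : LocallyIntegrableOn S (Set.Ioi 0) := by
    refine LocallyIntegrable.locallyIntegrableOn ?_ _
    refine (locallyIntegrable_const (1 + q : ℝ)).mono hSm.aestronglyMeasurable ?_
    refine .of_forall fun t ↦ (hSle t).trans (le_abs_self _)
  have hmel (s : ℂ) : mellin S (-s) = ∫ t in Set.Ioi (1 : ℝ), S t * t ^ (-(s + 1)) := by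
    rw [← integral_Ici_eq_integral_Ioi, mellin,
      setIntegral_eq_of_subset_of_forall_sdiff_eq_zero measurableSet_Ioi
        (Set.Ici_subset_Ioi.mpr one_pos)]
    · refine setIntegral_congr_fun measurableSet_Ici fun t _ ↦ ?_
      simp only [smul_eq_mul]
      rw [mul_comm, neg_add, ← sub_eq_add_neg]
    · intro t ht
      simp [hS0 t (not_le.mp ht.2)]
  have hdiff (s : ℂ) (hs : 0 < s.re) : DifferentiableAt ℂ (fun s ↦ s * mellin S (-s)) s := by
    refine differentiableAt_id.mul ?_
    suffices h : DifferentiableAt ℂ (mellin S) (-s) from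
      h.comp s differentiable_neg.differentiableAt
    refine mellin_differentiableAt_of_isBigO_rpow (a := 0) (b := -s.re - 1) hloc ?_ (by simpa) ?_
      (by simp)
    · exact Asymptotics.IsBigO.of_bound (1 + q) (.of_forall fun t ↦ by simpa using hSle t)
    · refine Asymptotics.IsBigO.of_bound 0 ?_
      filter_upwards [Ioo_mem_nhdsGT one_pos] with t ht
      simp [hS0 t ht.2]
  have heq : Set.EqOn (LFunction χ) (fun s ↦ s * mellin S (-s)) {s | 0 < s.re} := by
    have hopen : IsOpen {s : ℂ | 0 < s.re} := isOpen_lt continuous_const continuous_re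
    have h1 : AnalyticOnNhd ℂ (LFunction χ) {s | 0 < s.re} :=
      (differentiable_LFunction hχ).differentiableOn.analyticOnNhd hopen
    have h2 : AnalyticOnNhd ℂ (fun s ↦ s * mellin S (-s)) {s | 0 < s.re} :=
      DifferentiableOn.analyticOnNhd (fun s hs ↦ (hdiff s hs).differentiableWithinAt) hopen
    refine h1.eqOn_of_preconnected_of_eventuallyEq h2
      (convex_halfSpace_re_gt 0).isPreconnected (z₀ := 2) (by simp) ?_
    filter_upwards [(isOpen_lt continuous_const continuous_re).mem_nhds
      (show (2 : ℂ) ∈ {s : ℂ | 1 < s.re} by simp)] with s hs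
    rw [LFunction_eq_LSeries χ hs, hmel, LSeries_eq_mul_integral (fun n : ℕ ↦ χ (n : ZMod q))
      le_rfl (one_pos.trans hs) (LSeriesSummable_of_one_lt_re χ hs)]
    refine Asymptotics.IsBigO.of_bound (1 + q) (.of_forall fun n ↦ ?_)
    simpa [hS] using hSle n
  refine ⟨4 * (1 + q), by linarith [Nat.cast_nonneg (α := ℝ) q], fun s hs ↦ ?_⟩
  have hs0 : 0 < s.re := by linarith
  rw [heq hs0, norm_mul, mul_comm]
  gcongr
  rw [hmel]
  have hinteg : IntegrableOn (fun t : ℝ ↦ (1 + q : ℝ) * t ^ (-(s.re + 1))) (Set.Ioi 1) :=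
    (integrableOn_Ioi_rpow_of_lt (by linarith) one_pos).const_mul _
  calc _ ≤ ∫ t in Set.Ioi (1 : ℝ), (1 + q : ℝ) * t ^ (-(s.re + 1)) := by
        refine norm_integral_le_of_norm_le hinteg ?_
        filter_upwards [ae_restrict_mem measurableSet_Ioi] with t ht
        have ht0 : 0 < t := one_pos.trans ht
        rw [norm_mul, norm_cpow_eq_rpow_re_of_pos ht0]
        simp only [neg_re, add_re, one_re]
        gcongr
        exact hSle t
    _ = (1 + q) / s.re := by
        rw [integral_const_mul, integral_Ioi_rpow_of_lt (by linarith) one_pos]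
        simp [div_eq_mul_inv]
    _ ≤ 4 * (1 + q) := by
        rw [div_le_iff₀ hs0]
        nlinarith [Nat.cast_nonneg (α := ℝ) q]

/-- A nonvanishing holomorphic function on a convex open set has a holomorphic logarithm. -/
theorem Convex.exists_differentiableOn_exp_eq {U : Set ℂ} (hUc : Convex ℝ U) (hUo : IsOpen U)
    (hU : U.Nonempty) {f : ℂ → ℂ} (hf : DifferentiableOn ℂ f U) (h0 : ∀ z ∈ U, f z ≠ 0) :
    ∃ l : ℂ → ℂ, DifferentiableOn ℂ l U ∧ ∀ z ∈ U, exp (l z) = f z := by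
  have hsc : IsSimplyConnected U := by
    have := hUc.contractibleSpace hU
    exact (inferInstance : SimplyConnectedSpace U)
  obtain ⟨l, hlc, hl⟩ := exists_continuousOn_eqOn_exp_comp hsc hUo hf.continuousOn
    (by rintro ⟨z, hz, hz'⟩; exact h0 z hz hz')
  refine ⟨l, fun z hz ↦ ?_, hl⟩
  have hd : HasDerivAt f (deriv f z) z := (hf.differentiableAt (hUo.mem_nhds hz)).hasDerivAt
  obtain ⟨w, hw⟩ : ∃ w, w = f z := ⟨_, rfl⟩
  have hlz : exp (l z) = f z := hl hz
  have hcont : ContinuousAt l z := hlc.continuousAt (hUo.mem_nhds hz)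
  have hderiv : HasDerivAt (fun y ↦ l z + log (f y / f z)) (deriv f z / f z / (f z / f z)) z := by
    refine HasDerivAt.const_add _ (HasDerivAt.clog (hd.div_const _) ?_)
    simp [div_self (h0 z hz)]
  refine (hderiv.congr_of_eventuallyEq ?_).differentiableAt.differentiableWithinAt
  have him : ∀ᶠ y in nhds z, ‖l y - l z‖ < 1 := by
    simpa [dist_eq_norm] using Metric.tendsto_nhds.mp hcont 1 one_pos
  filter_upwards [him, hUo.mem_nhds hz] with y hy hyU
  have hly : exp (l y) = f y := hl hyU
  have hI : |(l y - l z).im| < 1 := (abs_im_le_norm _).trans_lt hy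
  rw [← hly, ← hlz, ← exp_sub, log_exp]
  · ring
  · linarith [(abs_lt.mp hI).1, Real.pi_gt_three]
  · linarith [(abs_lt.mp hI).2, Real.pi_gt_three]

theorem one_add_mul_exp_neg_sq_le (x : ℝ) : (1 + |x|) * Real.exp (-x ^ 2) ≤ 2 := by
  rw [Real.exp_neg, ← div_eq_mul_inv, div_le_iff₀ (Real.exp_pos _), ← sq_abs]
  nlinarith [Real.add_one_le_exp (|x| ^ 2), sq_nonneg (|x| - 1), abs_nonneg x]

open HadamardThreeLines in
/-- A version of the Hadamard three-lines theorem for functions of moderate growth, obtained by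
multiplying with a Gaussian factor. -/
theorem norm_le_interp_of_moderate_growth {h : ℂ → ℂ} {l u : ℝ} (hl : 0 ≤ l) (hlu : l < u)
    (hu : u ≤ 3) (hd : DiffContOnCl ℂ h (verticalStrip l u)) {w₀ w₁ : ℝ → ℝ}
    (hw₀ : ∀ t t', w₀ t ≤ w₀ t' * (1 + |t - t'|)) (hw₁ : ∀ t t', w₁ t ≤ w₁ t' * (1 + |t - t'|))
    (h₀ : ∀ s ∈ verticalClosedStrip l u, ‖h s‖ ≤ w₀ s.im)
    (h₁ : ∀ s : ℂ, s.re = u → ‖h s‖ ≤ w₁ s.im) {s : ℂ} (hs : s ∈ verticalClosedStrip l u) :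
    ‖h s‖ ≤ 2 * Real.exp 9 *
      (w₀ s.im ^ (1 - (s.re - l) / (u - l)) * w₁ s.im ^ ((s.re - l) / (u - l))) := by
  set F : ℂ → ℂ := fun z ↦ h z * exp ((z - s.im * I) ^ 2) with hF
  have hw₀s : 0 ≤ w₀ s.im := (norm_nonneg _).trans (h₀ s hs)
  have hw₁s : 0 ≤ w₁ s.im := by simpa using (norm_nonneg _).trans (h₁ ⟨u, s.im⟩ rfl)
  have hgauss (z : ℂ) : ‖exp ((z - s.im * I) ^ 2)‖ = Real.exp (z.re ^ 2) *
      Real.exp (-(z.im - s.im) ^ 2) := by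
    rw [norm_exp, ← Real.exp_add]
    congr 1
    simp [pow_two]
    ring
  have hbound {w : ℝ → ℝ} (hw : ∀ t t', w t ≤ w t' * (1 + |t - t'|)) (hws : 0 ≤ w s.im) {z : ℂ}
      (hz : z ∈ verticalClosedStrip l u) (hzw : ‖h z‖ ≤ w z.im) :
      ‖F z‖ ≤ 2 * Real.exp 9 * w s.im := by
    have hz' : l ≤ z.re ∧ z.re ≤ u := hz
    have h9 : Real.exp (z.re ^ 2) ≤ Real.exp 9 := by
      gcongr
      nlinarith
    calc ‖F z‖ = ‖h z‖ * (Real.exp (z.re ^ 2) * Real.exp (-(z.im - s.im) ^ 2)) := by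
          rw [hF, norm_mul, hgauss]
      _ ≤ (w s.im * (1 + |z.im - s.im|)) * (Real.exp 9 * Real.exp (-(z.im - s.im) ^ 2)) := by
          gcongr
          exact hzw.trans (hw _ _)
      _ = w s.im * Real.exp 9 * ((1 + |z.im - s.im|) * Real.exp (-(z.im - s.im) ^ 2)) := by ring
      _ ≤ w s.im * Real.exp 9 * 2 := by
          gcongr
          exact one_add_mul_exp_neg_sq_le _
      _ = _ := by ring
  have hFd : DiffContOnCl ℂ F (verticalStrip l u) :=
    hd.smul (Differentiable.diffContOnCl (by fun_prop) : DiffContOnCl ℂ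
      (fun z ↦ exp ((z - s.im * I) ^ 2)) (verticalStrip l u))
  have hkey := norm_le_interp_of_mem_verticalClosedStrip' hlu hs hFd
    (a := 2 * Real.exp 9 * w₀ s.im) (b := 2 * Real.exp 9 * w₁ s.im)
    ⟨2 * Real.exp 9 * w₀ s.im, by
      rintro _ ⟨z, hz, rfl⟩
      exact hbound hw₀ hw₀s hz (h₀ z hz)⟩
    (fun z hz ↦ by
      have hz' : z.re = l := hz
      have hzs : z ∈ verticalClosedStrip l u := ⟨hz'.ge, hz'.le.trans hlu.le⟩
      exact hbound hw₀ hw₀s hzs (h₀ z hzs))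
    (fun z hz ↦ by
      have hz' : z.re = u := hz
      exact hbound hw₁ hw₁s ⟨hlu.le.trans hz'.ge, hz'.le⟩ (h₁ z hz'))
  have hFs : ‖h s‖ ≤ ‖F s‖ := by
    rw [hF, norm_mul, hgauss]
    simp only [sub_self]
    refine le_mul_of_one_le_right (norm_nonneg _) ?_
    simp
    positivity
  refine hFs.trans (hkey.trans_eq ?_)
  rw [Real.mul_rpow (by positivity) hw₀s, Real.mul_rpow (by positivity) hw₁s,
    mul_mul_mul_comm, ← Real.rpow_add (by positivity)]
  simp

theorem one_add_log_one_add_abs_le (t t' : ℝ) :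
    1 + Real.log (1 + |t|) ≤ (1 + Real.log (1 + |t'|)) * (1 + |t - t'|) := by
  have h1 : 1 + |t| ≤ (1 + |t'|) * (1 + |t - t'|) := by
    have := abs_sub_abs_le_abs_sub t t'
    nlinarith [abs_nonneg t', abs_nonneg (t - t')]
  have h2 : Real.log (1 + |t|) ≤ Real.log (1 + |t'|) + |t - t'| := by
    refine (Real.log_le_log (by positivity) h1).trans ?_
    rw [Real.log_mul (by positivity) (by positivity)]
    linarith [Real.log_le_sub_one_of_pos (show 0 < 1 + |t - t'| by positivity)]
  have h3 : 0 ≤ Real.log (1 + |t'|) := Real.log_nonneg (by linarith [abs_nonneg t'])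
  nlinarith [abs_nonneg (t - t')]

theorem exists_mul_rpow_le (c : ℝ) (hc : 0 ≤ c) {κ ε : ℝ} (hκ : 0 < κ) (hε : 0 < ε) :
    ∃ D : ℝ, ∀ x : ℝ, 1 ≤ x → c * x ^ (1 - κ) ≤ D + ε * x := by
  have h : Filter.Tendsto (fun x : ℝ ↦ c * x ^ (-κ)) Filter.atTop (nhds 0) := by
    simpa using (tendsto_rpow_neg_atTop hκ).const_mul c
  obtain ⟨X, hX⟩ := Filter.eventually_atTop.mp (h.eventually (ge_mem_nhds hε))
  refine ⟨c * |X|, fun x hx ↦ ?_⟩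
  have hx0 : 0 < x := by linarith
  have hsplit : x ^ (1 - κ) = x * x ^ (-κ) := by
    rw [sub_eq_add_neg, Real.rpow_add hx0, Real.rpow_one]
  rcases le_total X x with hXx | hXx
  · rw [hsplit, mul_left_comm]
    nlinarith [hX x hXx, mul_nonneg hc (abs_nonneg X)]
  · have h1 : x ^ (-κ) ≤ 1 := Real.rpow_le_one_of_one_le_of_nonpos hx (by linarith)
    have h2 : x ^ (1 - κ) ≤ |X| := by
      rw [hsplit]
      nlinarith [le_abs_self X]
    nlinarith [mul_le_mul_of_nonneg_left h2 hc]

/-- If `exp ∘ l` is within `3 / 4` of `1` on `re s > 2`, then `l` is bounded there. -/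
theorem exists_norm_le_of_norm_exp_sub_one_le {l f : ℂ → ℂ}
    (hl : DifferentiableOn ℂ l {s | 1 / 2 < s.re}) (hexp : ∀ s : ℂ, 1 / 2 < s.re → exp (l s) = f s)
    (hnear : ∀ s : ℂ, 2 < s.re → ‖f s - 1‖ ≤ 3 / 4) :
    ∃ B : ℝ, 0 ≤ B ∧ ∀ s : ℂ, 2 < s.re → ‖l s‖ ≤ B := by
  have hopen : IsOpen {s : ℂ | 2 < s.re} := isOpen_lt continuous_const continuous_re
  have hopen' : IsOpen {s : ℂ | 1 / 2 < s.re} := isOpen_lt continuous_const continuous_re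
  have hslit (s : ℂ) (hs : 2 < s.re) : f s ∈ slitPlane := by
    refine mem_slitPlane_of_norm_lt_one (z := f s - 1) ?_ |> fun h ↦ by simpa using h
    linarith [hnear s hs]
  have hlog (s : ℂ) (hs : 2 < s.re) : ‖log (f s)‖ ≤ 4 := by
    have h := norm_log_one_add_le (z := f s - 1) (by linarith [hnear s hs])
    rw [add_sub_cancel] at h
    refine h.trans ?_
    have h1 := hnear s hs
    have h2 := norm_nonneg (f s - 1)
    have h3 : (1 - ‖f s - 1‖)⁻¹ ≤ 4 := by
      rw [inv_le_comm₀ (by linarith) (by norm_num)]; linarith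
    have h4 : ‖f s - 1‖ ^ 2 ≤ (3 / 4) ^ 2 := by gcongr
    have h5 : 0 ≤ (1 - ‖f s - 1‖)⁻¹ := inv_nonneg.mpr (by linarith)
    nlinarith
  have hderiv (s : ℂ) (hs : 2 < s.re) : HasDerivAt (fun s ↦ l s - log (f s)) 0 s := by
    have hs' : 1 / 2 < s.re := by linarith
    have h1 : HasDerivAt l (deriv l s) s :=
      (hl.differentiableAt (hopen'.mem_nhds hs')).hasDerivAt
    have h2 : HasDerivAt f (exp (l s) * deriv l s) s := by
      refine h1.cexp.congr_of_eventuallyEq ?_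
      filter_upwards [hopen'.mem_nhds hs'] with z hz using (hexp z hz).symm
    have h3 := h1.sub (h2.clog (hslit s hs))
    rwa [← hexp s hs', mul_div_cancel_left₀ _ (exp_ne_zero _), sub_self] at h3
  refine ⟨‖l 3 - log (f 3)‖ + 4, by positivity, fun s hs ↦ ?_⟩
  have hconst : l s - log (f s) = l 3 - log (f 3) := by
    refine (convex_halfSpace_re_gt 2).is_const_of_fderivWithin_eq_zero (𝕜 := ℂ)
      (f := fun s ↦ l s - log (f s))
      (fun z hz ↦ (hderiv z hz).differentiableAt.differentiableWithinAt) (fun z hz ↦ ?_) hs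
      (by simp; norm_num)
    rw [fderivWithin_of_isOpen hopen hz]
    ext
    simp [(hderiv z hz).deriv]
  calc ‖l s‖ = ‖(l 3 - log (f 3)) + log (f s)‖ := by rw [← hconst]; simp
    _ ≤ _ := (norm_add_le _ _).trans (by gcongr; exact hlog s hs)

open HadamardThreeLines in
/-- Littlewood's argument: a function of finite order that does not vanish in `re s > 1 / 2` and
is close to `1` far to the right is `O(|t| ^ ε)` strictly to the right of `re s = 1 / 2`. -/
theorem exists_norm_le_rpow_of_ne_zero {f : ℂ → ℂ} (hf : Differentiable ℂ f) {C : ℝ} (hC : 1 ≤ C)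
    (hgrow : ∀ s : ℂ, 1 / 4 ≤ s.re → ‖f s‖ ≤ C * ‖s‖) (hnz : ∀ s : ℂ, 1 / 2 < s.re → f s ≠ 0)
    (hnear : ∀ s : ℂ, 2 < s.re → ‖f s - 1‖ ≤ 3 / 4) {δ ε : ℝ} (hδ : 0 < δ) (hδ' : δ ≤ 1)
    (hε : 0 < ε) :
    ∃ K : ℝ, 0 < K ∧ ∀ s : ℂ, 1 / 2 + δ ≤ s.re → s.re ≤ 3 → ‖f s‖ ≤ K * (1 + |s.im|) ^ ε := by
  obtain ⟨l, hl, hexp⟩ := (convex_halfSpace_re_gt (1 / 2)).exists_differentiableOn_exp_eq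
    (isOpen_lt continuous_const continuous_re) ⟨1, by norm_num⟩ hf.differentiableOn
    (fun z hz ↦ hnz z hz)
  obtain ⟨B, hB0, hB⟩ := exists_norm_le_of_norm_exp_sub_one_le hl (fun s hs ↦ hexp s hs) hnear
  have hlogpos (t : ℝ) : 0 ≤ Real.log (1 + |t|) := Real.log_nonneg (by linarith [abs_nonneg t])
  have hlogC : 0 ≤ Real.log (6 * C) := Real.log_nonneg (by linarith)
  set η := δ / 2 with hη
  have hη0 : 0 < η := by positivity
  obtain ⟨A, hA1, hA⟩ : ∃ A : ℝ, B ≤ A ∧ ∀ s : ℂ, 1 / 2 + η ≤ s.re → s.re ≤ 3 →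
      ‖l s‖ ≤ A * (1 + Real.log (1 + |s.im|)) := by
    refine ⟨(5 * (Real.log (6 * C) + 2) + 5 * B) / η, ?_, fun s hs hs3 ↦ ?_⟩
    · rw [le_div_iff₀ hη0]
      nlinarith
    set M := Real.log (6 * C * (1 + |s.im|)) + 1 with hM
    have hMlog : Real.log (6 * C * (1 + |s.im|)) = Real.log (6 * C) + Real.log (1 + |s.im|) :=
      Real.log_mul (by positivity) (by positivity)
    have hball : Set.MapsTo (fun z ↦ (3 + s.im * I) + z) (Metric.ball (0 : ℂ) (5 / 2))
        {z : ℂ | 1 / 2 < z.re} := by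
      intro z hz
      have h1 : ‖z‖ < 5 / 2 := by simpa using hz
      have h2 := (abs_le.mp (abs_re_le_norm z)).1
      simp only [Set.mem_ofPred_eq, add_re, re_ofNat, mul_re, ofReal_re, I_re, ofReal_im, I_im]
      linarith
    have hsz : s = (3 + s.im * I) + ((s.re - 3 : ℝ) : ℂ) := by
      apply Complex.ext <;> simp
    have hnorm : ‖((s.re - 3 : ℝ) : ℂ)‖ = 3 - s.re := by
      rw [norm_real, Real.norm_eq_abs, abs_sub_comm, abs_of_nonneg (by linarith)]
    have hbc := borelCaratheodory (f := fun z ↦ l ((3 + s.im * I) + z)) (M := M) (R := 5 / 2)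
      (z := ((s.re - 3 : ℝ) : ℂ)) (by linarith [hlogpos s.im])
      (hl.comp (by fun_prop) hball) (fun z hz ↦ by
        have hz1 : 1 / 2 < (3 + s.im * I + z).re := hball hz
        have hz2 : ‖z‖ < 5 / 2 := by simpa using hz
        have h1 : ‖f (3 + s.im * I + z)‖ ≤ 6 * C * (1 + |s.im|) := by
          refine (hgrow _ (by linarith)).trans ?_
          have h2 : ‖3 + s.im * I + z‖ ≤ 3 + |s.im| + ‖z‖ := by
            refine (norm_add_le _ _).trans ?_
            gcongr
            refine (norm_add_le _ _).trans ?_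
            simp
          nlinarith [abs_nonneg s.im]
        rw [← hexp _ hz1, norm_exp] at h1
        have h3 := Real.log_le_log (Real.exp_pos _) h1
        rw [Real.log_exp] at h3
        simp only [Set.mem_ofPred_eq]
        linarith) (by norm_num) (by
        rw [mem_ball_zero_iff, hnorm]; linarith)
    rw [← hsz, hnorm] at hbc
    have hl0 : ‖l (3 + s.im * I + 0)‖ ≤ B := hB _ (by simp; norm_num)
    have hden : η ≤ 5 / 2 - (3 - s.re) := by linarith
    calc ‖l s‖ ≤ _ := hbc
      _ = (2 * M * (3 - s.re) + ‖l (3 + s.im * I + 0)‖ * (5 / 2 + (3 - s.re))) /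
          (5 / 2 - (3 - s.re)) := by rw [add_div]
      _ ≤ (2 * M * (5 / 2) + B * (5 / 2 + 5 / 2)) / η := by
          have hM0 : 0 ≤ M := by linarith [hlogpos s.im]
          gcongr
          all_goals first | positivity | linarith
      _ ≤ (5 * (Real.log (6 * C) + 2) + 5 * B) / η * (1 + Real.log (1 + |s.im|)) := by
          rw [div_mul_eq_mul_div]
          gcongr
          rw [hM, hMlog]
          nlinarith [hlogpos s.im, mul_nonneg hlogC (hlogpos s.im), mul_nonneg hB0 (hlogpos s.im)]
  have hA0 : 0 ≤ A := hB0.trans hA1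
  have hlower {s : ℂ} (hs : 1 / 2 + δ ≤ s.re) (hs3 : s.re ≤ 3) :
      ‖l s‖ ≤ 2 * Real.exp 9 * A * (1 + Real.log (1 + |s.im|)) ^ (1 - η / (5 / 2)) := by
    have hLg : 1 ≤ 1 + Real.log (1 + |s.im|) := by linarith [hlogpos s.im]
    have h := norm_le_interp_of_moderate_growth (h := l) (l := 1 / 2 + η) (u := 3) (by positivity)
      (by linarith) le_rfl (DifferentiableOn.diffContOnCl (hl.mono ?_))
      (w₀ := fun t ↦ A * (1 + Real.log (1 + |t|))) (w₁ := fun _ ↦ A)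
      (fun t t' ↦ by
        rw [mul_assoc]; gcongr; exact one_add_log_one_add_abs_le t t')
      (fun t t' ↦ le_mul_of_one_le_right hA0 (by linarith [abs_nonneg (t - t')]))
      (fun s hs ↦ hA s hs.1 hs.2)
      (fun s hs ↦ (hB s (by rw [hs]; norm_num)).trans hA1) (s := s) ⟨by linarith, hs3⟩
    · refine h.trans ?_
      rw [mul_assoc _ A]
      refine mul_le_mul_of_nonneg_left ?_ (by positivity)
      set θ := (s.re - (1 / 2 + η)) / (3 - (1 / 2 + η)) with hθ
      have hθ1 : η / (5 / 2) ≤ θ := by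
        rw [hθ]
        gcongr <;> linarith
      rw [Real.mul_rpow hA0 (by linarith), mul_right_comm,
        ← Real.rpow_add' hA0 (by simp), sub_add_cancel, Real.rpow_one]
      gcongr
    · refine (closure_mono (t := {z : ℂ | 1 / 2 + η ≤ z.re}) fun z hz ↦ ?_).trans fun z hz ↦ ?_
      · exact hz.1.le
      · rw [(isClosed_le continuous_const continuous_re).closure_eq] at hz
        exact (show (1 : ℝ) / 2 < 1 / 2 + η by linarith).trans_le hz
  obtain ⟨D, hD⟩ := exists_mul_rpow_le (2 * Real.exp 9 * A) (by positivity)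
    (κ := η / (5 / 2)) (by positivity) hε
  refine ⟨Real.exp (D + ε), Real.exp_pos _, fun s hs hs3 ↦ ?_⟩
  have h1 : (l s).re ≤ D + ε + ε * Real.log (1 + |s.im|) := by
    have h := hD (1 + Real.log (1 + |s.im|)) (by linarith [hlogpos s.im])
    linarith [(re_le_norm _).trans (hlower hs hs3)]
  rw [← hexp s (show 1 / 2 < s.re by linarith), norm_exp, Real.rpow_def_of_pos (by positivity),
    ← Real.exp_add, mul_comm (Real.log _)]
  gcongr

theorem one_add_abs_rpow_le {ε : ℝ} (hε : 0 ≤ ε) (t t' : ℝ) :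
    (1 + |t|) ^ ε ≤ (1 + |t'|) ^ ε * (1 + |t - t'|) ^ ε := by
  rw [← Real.mul_rpow (by positivity) (by positivity)]
  gcongr
  have := abs_sub_abs_le_abs_sub t t'
  nlinarith [abs_nonneg t', abs_nonneg (t - t')]

open HadamardThreeLines in
/-- The Lindelöf bound in a neighbourhood of the critical line. -/
theorem exists_norm_le_rpow_near_half {f : ℂ → ℂ} (hf : Differentiable ℂ f) {C : ℝ} (hC : 1 ≤ C)
    (hgrow : ∀ s : ℂ, 1 / 4 ≤ s.re → ‖f s‖ ≤ C * ‖s‖) (hnz : ∀ s : ℂ, 1 / 2 < s.re → f s ≠ 0)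
    (hnear : ∀ s : ℂ, 2 < s.re → ‖f s - 1‖ ≤ 3 / 4) {ε : ℝ} (hε : 0 < ε) (hε' : ε ≤ 1) :
    ∃ δ K : ℝ, 0 < δ ∧ 0 < K ∧ ∀ s : ℂ, |s.re - 1 / 2| ≤ δ → ‖f s‖ ≤ K * (1 + |s.im|) ^ ε := by
  set δ := ε / 24 with hδ
  have hδ0 : 0 < δ := by positivity
  obtain ⟨K, hK0, hK⟩ := exists_norm_le_rpow_of_ne_zero hf hC hgrow hnz hnear (δ := 2 * δ)
    (ε := ε / 2) (by positivity) (by linarith) (by positivity)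
  set A := max (2 * C) K with hA
  have hA1 : 1 ≤ A := by linarith [le_max_left (2 * C) K]
  have hA0 : 0 < A := by linarith
  refine ⟨δ, 2 * Real.exp 9 * A, hδ0, by positivity, fun s hs ↦ ?_⟩
  have hs' := abs_le.mp hs
  have ht1 : 1 ≤ 1 + |s.im| := by linarith [abs_nonneg s.im]
  have h := norm_le_interp_of_moderate_growth (h := f) (l := 1 / 4) (u := 1 / 2 + 2 * δ)
    (by norm_num) (by linarith) (by linarith) hf.diffContOnCl
    (w₀ := fun t ↦ A * (1 + |t|)) (w₁ := fun t ↦ A * (1 + |t|) ^ (ε / 2))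
    (fun t t' ↦ by
      rw [mul_assoc]
      gcongr
      simpa using one_add_abs_rpow_le zero_le_one t t')
    (fun t t' ↦ by
      rw [mul_assoc]
      gcongr
      refine (one_add_abs_rpow_le (by positivity) t t').trans ?_
      gcongr
      exact Real.rpow_le_self_of_one_le (by linarith [abs_nonneg (t - t')]) (by linarith))
    (fun z hz ↦ by
      have hz' : 1 / 4 ≤ z.re ∧ z.re ≤ 1 / 2 + 2 * δ := hz
      have h1 : ‖z‖ ≤ 2 * (1 + |z.im|) := by
        refine (norm_le_abs_re_add_abs_im z).trans ?_
        rw [abs_of_nonneg (by linarith)]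
        linarith [abs_nonneg z.im]
      calc ‖f z‖ ≤ C * (2 * (1 + |z.im|)) := (hgrow z hz'.1).trans (by gcongr)
        _ = 2 * C * (1 + |z.im|) := by ring
        _ ≤ A * (1 + |z.im|) := by gcongr; exact le_max_left _ _)
    (fun z hz ↦ (hK z hz.ge (by linarith)).trans (by gcongr; exact le_max_right _ _))
    (s := s) ⟨by linarith, by linarith⟩
  refine h.trans ?_
  rw [mul_assoc _ A]
  refine mul_le_mul_of_nonneg_left ?_ (by positivity)
  set θ := (s.re - 1 / 4) / (1 / 2 + 2 * δ - 1 / 4) with hθ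
  have hden : 0 < 1 / 2 + 2 * δ - 1 / 4 := by linarith
  have hθ1 : θ ≤ 1 := by
    rw [hθ, div_le_one hden]; linarith
  have hθ0 : 1 - ε / 2 ≤ θ := by
    rw [hθ, le_div_iff₀ hden]
    nlinarith
  rw [Real.mul_rpow hA0.le (by positivity), Real.mul_rpow hA0.le (by positivity),
    mul_mul_mul_comm, ← Real.rpow_add hA0, sub_add_cancel, Real.rpow_one, ← Real.rpow_mul
    (by positivity), ← Real.rpow_add (by positivity)]
  gcongr
  nlinarith

/-- The derivative on the critical line is `O(|t| ^ ε)`. -/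
theorem exists_norm_deriv_le_rpow {f : ℂ → ℂ} (hf : Differentiable ℂ f) {C : ℝ} (hC : 1 ≤ C)
    (hgrow : ∀ s : ℂ, 1 / 4 ≤ s.re → ‖f s‖ ≤ C * ‖s‖) (hnz : ∀ s : ℂ, 1 / 2 < s.re → f s ≠ 0)
    (hnear : ∀ s : ℂ, 2 < s.re → ‖f s - 1‖ ≤ 3 / 4) {ε : ℝ} (hε : 0 < ε) (hε' : ε ≤ 1) :
    ∃ K : ℝ, 0 < K ∧ ∀ s : ℂ, s.re = 1 / 2 → ‖deriv f s‖ ≤ K * (1 + |s.im|) ^ ε := by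
  obtain ⟨δ, K, hδ, hK, h⟩ := exists_norm_le_rpow_near_half hf hC hgrow hnz hnear hε hε'
  refine ⟨K * (1 + δ) ^ ε / δ, by positivity, fun s hs ↦ ?_⟩
  rw [div_mul_eq_mul_div]
  refine norm_deriv_le_of_forall_mem_sphere_norm_le hδ hf.diffContOnCl fun z hz ↦ ?_
  have hz' : ‖z - s‖ = δ := by simpa using hz
  have hre : |z.re - 1 / 2| ≤ δ := by
    rw [← hs, ← sub_re, ← hz']
    exact abs_re_le_norm _
  have him : |z.im - s.im| ≤ δ := by
    rw [← sub_im, ← hz']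
    exact abs_im_le_norm _
  refine (h z hre).trans ?_
  rw [mul_assoc, mul_comm ((1 + δ) ^ ε)]
  gcongr
  exact (one_add_abs_rpow_le hε.le z.im s.im).trans (by gcongr)

/-- Short vertical segments of the critical line contain `O(log |t|)` zeros. -/
theorem exists_card_zeros_le {f : ℂ → ℂ} (hf : Differentiable ℂ f) {C : ℝ} (hC : 1 ≤ C)
    (hgrow : ∀ s : ℂ, 1 / 4 ≤ s.re → ‖f s‖ ≤ C * ‖s‖)
    (hnear : ∀ s : ℂ, 2 < s.re → ‖f s - 1‖ ≤ 3 / 4) :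
    ∃ K : ℝ, 0 < K ∧ ∀ (t : ℝ) (F : Finset ℝ),
      (∀ γ ∈ F, f (1 / 2 + I * γ) = 0 ∧ |γ - t| ≤ 1 / 2) →
      (F.card : ℝ) ≤ K * (1 + Real.log (1 + |t|)) := by
  have hlog0 : 0 < Real.log (2.7 / 2.6) := Real.log_pos (by norm_num)
  have hlogC : 0 ≤ Real.log (24 * C) := Real.log_nonneg (by linarith)
  refine ⟨(1 + Real.log (24 * C)) / Real.log (2.7 / 2.6), by positivity, fun t F hF ↦ ?_⟩
  set c : ℂ := 3 + t * I with hc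
  have hcre : c.re = 3 := by simp [hc]
  have hfc : 1 / 4 ≤ ‖f c‖ := by
    have h1 := hnear c (by rw [hcre]; norm_num)
    have h2 := norm_sub_norm_le (1 : ℂ) (1 - f c)
    rw [norm_sub_rev 1 (f c), norm_one, sub_sub_cancel] at h2
    linarith
  have hfc0 : f c ≠ 0 := norm_pos_iff.mp (by linarith)
  have hM : 1 ≤ 6 * C * (1 + |t|) := by nlinarith [abs_nonneg t]
  have hjensen := AnalyticOnNhd.sum_divisor_le (f := f) (c := c) (r := 2.6) (R := 2.7)
    (M := 6 * C * (1 + |t|)) (by norm_num) (by norm_num [abs_of_pos]) hM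
    (hf.differentiableOn.analyticOnNhd isOpen_univ |>.mono (Set.subset_univ _)) hfc0
    (fun z hz ↦ by
      have hz' : ‖z - c‖ = 2.7 := by
        have h : ‖z - c‖ = |2.7| := by simpa using hz
        rwa [abs_of_pos (by norm_num)] at h
      have h1 := (abs_le.mp (abs_re_le_norm (z - c))).1
      rw [sub_re, hcre, hz'] at h1
      refine (hgrow z (by norm_num at h1 ⊢; linarith)).trans ?_
      have h2 : ‖z‖ ≤ 2.7 + (3 + |t|) := by
        calc ‖z‖ = ‖(z - c) + c‖ := by simp
          _ ≤ ‖z - c‖ + ‖c‖ := norm_add_le _ _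
          _ ≤ _ := by
            rw [hz']
            gcongr
            refine (norm_add_le _ _).trans ?_
            simp
      nlinarith [abs_nonneg t])
  set D := MeromorphicOn.divisor f (Metric.closedBall c |(2.6 : ℝ)|) with hD
  have hana : AnalyticOnNhd ℂ f (Metric.closedBall c |(2.6 : ℝ)|) :=
    hf.differentiableOn.analyticOnNhd isOpen_univ |>.mono (Set.subset_univ _)
  have hDnn : ∀ u, 0 ≤ D u := fun u ↦ MeromorphicOn.AnalyticOnNhd.divisor_nonneg hana u
  have hDfin : (Function.support D).Finite := D.finiteSupport (isCompact_closedBall _ _)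
  set G : Finset ℂ := F.image (fun γ : ℝ ↦ (1 / 2 + I * γ : ℂ)) with hG
  have hcard : G.card = F.card := Finset.card_image_of_injective _ fun a b hab ↦ by simpa using hab
  have hone : ∀ u ∈ G, 1 ≤ D u := by
    intro u hu
    obtain ⟨γ, hγ, rfl⟩ := Finset.mem_image.mp hu
    obtain ⟨hz, hdist⟩ := hF γ hγ
    have hmem : (1 / 2 + I * γ : ℂ) ∈ Metric.closedBall c |(2.6 : ℝ)| := by
      rw [mem_closedBall_iff_norm, abs_of_pos (by norm_num)]
      refine abs_le_of_sq_le_sq' ?_ (by norm_num) |>.2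
      rw [Complex.sq_norm, Complex.normSq_apply]
      have h1 : (1 / 2 + I * γ - c : ℂ).re = -5 / 2 := by simp [hc]; norm_num
      have h2 : (1 / 2 + I * γ - c : ℂ).im = γ - t := by simp [hc]
      rw [h1, h2]
      have := abs_le.mp hdist
      nlinarith
    rw [hD, MeromorphicOn.AnalyticOnNhd.divisor_apply hana hmem]
    have hord : analyticOrderAt f (1 / 2 + I * γ : ℂ) ≠ 0 := by
      rw [(hana _ hmem).analyticOrderAt_ne_zero]
      exact hz
    have hord' : analyticOrderAt f (1 / 2 + I * γ : ℂ) ≠ ⊤ := by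
      intro h
      rw [analyticOrderAt_eq_top] at h
      have hana' := hf.differentiableOn.analyticOnNhd isOpen_univ
      exact hfc0 (hana'.eqOn_zero_of_preconnected_of_eventuallyEq_zero isPreconnected_univ
        (Set.mem_univ _) h (Set.mem_univ c))
    lift analyticOrderAt f (1 / 2 + I * γ : ℂ) to ℕ using hord' with m
    have : 1 ≤ m := Nat.one_le_iff_ne_zero.mpr (by exact_mod_cast hord)
    simpa using this
  have hsum : (F.card : ℤ) ≤ ∑ᶠ u, D u := by
    rw [finsum_eq_sum_of_support_subset (s := hDfin.toFinset ∪ G) _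
      (by simp [Set.subset_union_left])]
    calc (F.card : ℤ) = ∑ u ∈ G, 1 := by simp [hcard]
      _ ≤ ∑ u ∈ G, D u := Finset.sum_le_sum hone
      _ ≤ _ := Finset.sum_le_sum_of_subset_of_nonneg Finset.subset_union_right fun u _ _ ↦ hDnn u
  calc (F.card : ℝ) ≤ ((∑ᶠ u, D u : ℤ) : ℝ) := by exact_mod_cast hsum
    _ ≤ _ := hjensen
    _ ≤ Real.log (24 * C * (1 + |t|)) / Real.log (2.7 / 2.6) := by
      gcongr
      rw [div_le_iff₀ (by linarith)]
      nlinarith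
    _ ≤ _ := by
      rw [Real.log_mul (by positivity) (by positivity), div_mul_eq_mul_div]
      gcongr
      have : 0 ≤ Real.log (1 + |t|) := Real.log_nonneg (by linarith [abs_nonneg t])
      nlinarith

/-- An `L`-function is close to `1` far to the right. -/
theorem DirichletCharacter.norm_LFunction_sub_one_le {q : ℕ} [NeZero q]
    (χ : DirichletCharacter ℂ q) {s : ℂ} (hs : 2 < s.re) :
    ‖LFunction χ s - 1‖ ≤ 3 / 4 := by
  have hs1 : 1 < s.re := by linarith
  have hsum := LSeriesSummable_of_one_lt_re χ hs1
  rw [LFunction_eq_LSeries χ hs1, LSeries, hsum.tsum_eq_add_tsum_ite 1]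
  have h1 : LSeries.term (fun n ↦ χ (n : ZMod q)) s 1 = 1 := by simp [LSeries.term]
  rw [h1, add_sub_cancel_left]
  have hz := hasSum_zeta_two
  have hz' : HasSum (fun n : ℕ ↦ if n = 1 then (0 : ℝ) else 1 / (n : ℝ) ^ 2)
      (Real.pi ^ 2 / 6 - 1) := by
    have h := hz.update 1 0
    have h2 : (0 : ℝ) - 1 / ((1 : ℕ) : ℝ) ^ 2 + Real.pi ^ 2 / 6 = Real.pi ^ 2 / 6 - 1 := by
      norm_num
      ring
    rw [h2] at h
    have h3 : (fun n : ℕ ↦ if n = 1 then (0 : ℝ) else 1 / (n : ℝ) ^ 2) =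
        Function.update (fun n : ℕ ↦ 1 / (n : ℝ) ^ 2) 1 0 := by
      ext n
      rw [Function.update_apply]
    rwa [h3]
  refine (tsum_of_norm_bounded hz' fun n ↦ ?_).trans ?_
  · split_ifs with hn
    · simp
    · rcases eq_or_ne n 0 with rfl | hn0
      · simp
      · rw [LSeries.norm_term_eq, if_neg hn0]
        have hn1 : (1 : ℝ) ≤ n := by exact_mod_cast Nat.one_le_iff_ne_zero.mpr hn0
        gcongr
        · exact DirichletCharacter.norm_le_one χ _
        · rw [← Real.rpow_natCast]
          exact Real.rpow_le_rpow_of_exponent_le hn1 (by push_cast; linarith)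
  · nlinarith [Real.pi_lt_d2, Real.pi_pos]

/-- The Riemann hypothesis gives nonvanishing to the right of the critical line. -/
theorem DirichletCharacter.LFunction_ne_zero_of_half_lt_re {q : ℕ} [NeZero q]
    {χ : DirichletCharacter ℂ q} (hχ : χ ≠ 1)
    (hGRH : ∀ s : ℂ, LFunction χ s = 0 → 0 < s.re → s.re < 1 → s.re = 1 / 2)
    {s : ℂ} (hs : 1 / 2 < s.re) : LFunction χ s ≠ 0 := by
  intro h0
  rcases lt_or_ge s.re 1 with h1 | h1
  · linarith [hGRH s h0 (by linarith) h1]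
  · exact LFunction_ne_zero_of_one_le_re χ (.inl hχ) h1 h0

theorem summable_int_one_add_abs_rpow {s : ℝ} (hs : 1 < s) :
    Summable fun m : ℤ ↦ (1 + |(m : ℝ)|) ^ (-s) := by
  have h : Summable fun n : ℕ ↦ (1 + (n : ℝ)) ^ (-s) := by
    have := (Real.summable_one_div_nat_add_rpow 1 s).mpr hs
    refine this.congr fun n ↦ ?_
    rw [abs_of_nonneg (by positivity), Real.rpow_neg (by positivity), one_div, add_comm]
  refine Summable.of_nat_of_neg ?_ ?_ <;> simpa using h

/-- If unit intervals around `t` contain `O(log |t|)` points of `Z`, then sums over `Z` of decaying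
translates are `O(|t| ^ η)`. -/
theorem exists_sum_rpow_sub_le {Z : Set ℝ} {K : ℝ} (hK : 0 < K)
    (hcount : ∀ (t : ℝ) (F : Finset ℝ), (∀ γ ∈ F, γ ∈ Z ∧ |γ - t| ≤ 1 / 2) →
      (F.card : ℝ) ≤ K * (1 + Real.log (1 + |t|)))
    {η σ : ℝ} (hη : 0 < η) (hησ : η < σ) :
    ∃ K' : ℝ, 0 < K' ∧ ∀ (t : ℝ) (F : Finset ℝ), (∀ γ ∈ F, γ ∈ Z) →
      ∑ γ ∈ F, (1 + |γ - t|) ^ (-(1 + σ)) ≤ K' * (1 + |t|) ^ η := by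
  have hsum := summable_int_one_add_abs_rpow (s := 1 + σ - η) (by linarith)
  set S₀ := ∑' m : ℤ, (1 + |(m : ℝ)|) ^ (-(1 + σ - η)) with hS
  have hS0 : 0 ≤ S₀ := tsum_nonneg fun m ↦ by positivity
  have hlog (x : ℝ) (hx : 1 ≤ x) : 1 + Real.log x ≤ (1 + 1 / η) * x ^ η := by
    have h1 := Real.log_le_rpow_div (by linarith : 0 ≤ x) hη
    have h2 := Real.one_le_rpow hx hη.le
    rw [add_mul, one_mul, one_div_mul_eq_div]
    linarith
  set D := K * (1 + 1 / η) * 2 ^ η * 2 ^ (1 + σ) with hD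
  have hD0 : 0 < D := by positivity
  refine ⟨D * (S₀ + 1), by positivity, fun t F hF ↦ ?_⟩
  have hfib : ∀ m : ℤ, ∑ γ ∈ F with ⌊γ - t⌋ = m, (1 + |γ - t|) ^ (-(1 + σ)) ≤
      D * (1 + |t|) ^ η * (1 + |(m : ℝ)|) ^ (-(1 + σ - η)) := by
    intro m
    have hcard := hcount (t + m + 1 / 2) (F.filter fun γ ↦ ⌊γ - t⌋ = m) fun γ hγ ↦ by
      rw [Finset.mem_filter, Int.floor_eq_iff] at hγ
      exact ⟨hF γ hγ.1, abs_le.mpr ⟨by linarith [hγ.2.1], by linarith [hγ.2.2]⟩⟩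
    have hterm : ∀ γ ∈ F.filter (fun γ ↦ ⌊γ - t⌋ = m),
        (1 + |γ - t|) ^ (-(1 + σ)) ≤ 2 ^ (1 + σ) * (1 + |(m : ℝ)|) ^ (-(1 + σ)) := by
      intro γ hγ
      rw [Finset.mem_filter, Int.floor_eq_iff] at hγ
      have h1 : |(m : ℝ)| ≤ |γ - t| + 1 := by
        rw [abs_le]
        constructor <;> cases abs_cases (γ - t) <;> linarith [hγ.2.1, hγ.2.2]
      have h2 : (1 + |(m : ℝ)|) / 2 ≤ 1 + |γ - t| := by linarith [abs_nonneg (γ - t)]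
      refine (Real.rpow_le_rpow_of_nonpos (by positivity) h2 (by linarith)).trans_eq ?_
      rw [Real.div_rpow (by positivity) (by norm_num), Real.rpow_neg (by norm_num : (0 : ℝ) ≤ 2),
        div_inv_eq_mul, mul_comm]
    have hc2 : 1 + Real.log (1 + |t + m + 1 / 2|) ≤
        (1 + 1 / η) * ((1 + |t|) ^ η * (2 ^ η * (1 + |(m : ℝ)|) ^ η)) := by
      refine (hlog _ (by linarith [abs_nonneg (t + m + 1 / 2)])).trans ?_
      gcongr
      rw [← Real.mul_rpow (by positivity) (by positivity)]
      refine (one_add_abs_rpow_le hη.le _ t).trans ?_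
      gcongr
      rw [show t + m + 1 / 2 - t = (m : ℝ) + 1 / 2 by ring]
      have := abs_add_le (m : ℝ) (1 / 2)
      rw [abs_of_pos (by norm_num : (0 : ℝ) < 1 / 2)] at this
      linarith [abs_nonneg (m : ℝ)]
    have hcomb : (1 + |(m : ℝ)|) ^ (-(1 + σ - η)) =
        (1 + |(m : ℝ)|) ^ η * (1 + |(m : ℝ)|) ^ (-(1 + σ)) := by
      rw [← Real.rpow_add (by positivity)]
      ring_nf
    calc _ ≤ _ := Finset.sum_le_card_nsmul _ _ _ hterm
      _ ≤ K * ((1 + 1 / η) * ((1 + |t|) ^ η * (2 ^ η * (1 + |(m : ℝ)|) ^ η))) *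
          (2 ^ (1 + σ) * (1 + |(m : ℝ)|) ^ (-(1 + σ))) := by
        rw [nsmul_eq_mul]
        gcongr
        exact hcard.trans (by gcongr)
      _ = _ := by
        rw [hcomb, hD]
        ring
  calc ∑ γ ∈ F, (1 + |γ - t|) ^ (-(1 + σ))
      = ∑ m ∈ F.image (fun γ ↦ ⌊γ - t⌋), ∑ γ ∈ F with ⌊γ - t⌋ = m,
          (1 + |γ - t|) ^ (-(1 + σ)) :=
        (Finset.sum_fiberwise_of_maps_to (fun γ hγ ↦ Finset.mem_image_of_mem _ hγ) _).symm
    _ ≤ ∑ m ∈ F.image (fun γ ↦ ⌊γ - t⌋), D * (1 + |t|) ^ η *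
          (1 + |(m : ℝ)|) ^ (-(1 + σ - η)) := Finset.sum_le_sum fun m _ ↦ hfib m
    _ = D * (1 + |t|) ^ η * ∑ m ∈ F.image (fun γ ↦ ⌊γ - t⌋),
          (1 + |(m : ℝ)|) ^ (-(1 + σ - η)) := by rw [Finset.mul_sum]
    _ ≤ D * (1 + |t|) ^ η * (S₀ + 1) := by
        gcongr
        exact (hsum.sum_le_tsum _ fun m _ ↦ by positivity).trans (by linarith)
    _ = _ := by ring

theorem integrable_exp_neg_abs_mul_exp (t : ℝ) :
    Integrable (fun y : ℝ ↦ (Real.exp (-|y|) : ℂ) * exp (I * y * t)) ∧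
    ∫ y : ℝ, (Real.exp (-|y|) : ℂ) * exp (I * y * t) = 2 / (1 + t ^ 2) := by
  have h1 : Set.EqOn (fun y : ℝ ↦ (Real.exp (-|y|) : ℂ) * exp (I * y * t))
      (fun y : ℝ ↦ exp ((-1 + I * t) * y)) (Set.Ioi 0) := fun y hy ↦ by
    have hy' : 0 < y := hy
    simp only [abs_of_pos hy']
    rw [ofReal_exp, ← Complex.exp_add]
    push_cast
    ring_nf
  have h2 : Set.EqOn (fun y : ℝ ↦ (Real.exp (-|y|) : ℂ) * exp (I * y * t))
      (fun y : ℝ ↦ exp ((1 + I * t) * y)) (Set.Iic 0) := fun y hy ↦ by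
    have hy' : y ≤ 0 := hy
    simp only [abs_of_nonpos hy']
    rw [ofReal_exp, ← Complex.exp_add]
    push_cast
    ring_nf
  have hre1 : (-1 + I * t : ℂ).re < 0 := by simp
  have hre2 : 0 < (1 + I * t : ℂ).re := by simp
  have i1 : IntegrableOn (fun y : ℝ ↦ (Real.exp (-|y|) : ℂ) * exp (I * y * t)) (Set.Ioi 0) :=
    (integrableOn_exp_mul_complex_Ioi hre1 0).congr_fun h1.symm measurableSet_Ioi
  have i2 : IntegrableOn (fun y : ℝ ↦ (Real.exp (-|y|) : ℂ) * exp (I * y * t)) (Set.Iic 0) :=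
    (integrableOn_exp_mul_complex_Iic hre2 0).congr_fun h2.symm measurableSet_Iic
  refine ⟨by rw [← integrableOn_univ, ← Set.Iic_union_Ioi (a := (0 : ℝ))]; exact i2.union i1, ?_⟩
  rw [← intervalIntegral.integral_Iic_add_Ioi i2 i1, setIntegral_congr_fun measurableSet_Ioi h1,
    setIntegral_congr_fun measurableSet_Iic h2, integral_exp_mul_complex_Ioi hre1,
    integral_exp_mul_complex_Iic hre2]
  have n1 : (-1 + I * t : ℂ) ≠ 0 := fun h ↦ by simp [h] at hre1
  have n2 : (1 + I * t : ℂ) ≠ 0 := fun h ↦ by simp [h] at hre2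
  have n3 : (1 + t ^ 2 : ℂ) ≠ 0 := by
    have : (0 : ℝ) < 1 + t ^ 2 := by positivity
    exact_mod_cast this.ne'
  simp only [ofReal_zero, mul_zero, Complex.exp_zero]
  rw [div_add_div _ _ n2 n1, div_eq_div_iff (mul_ne_zero n2 n1) n3]
  linear_combination (-2 * t ^ 2) * I_sq

open ComplexConjugate in
/-- Mean square of an exponential polynomial over a unit interval. -/
theorem integral_norm_sq_sum_exp_le (F : Finset ℝ) (b : ℝ → ℂ) (u : ℝ) :
    ∫ y in u..u + 1, ‖∑ γ ∈ F, b γ * exp (I * y * γ)‖ ^ 2 ≤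
      2 * Real.exp 1 * ∑ γ ∈ F, ‖b γ‖ ^ 2 * ∑ γ' ∈ F, 1 / (1 + (γ - γ') ^ 2) := by
  set g : ℝ → ℂ := fun γ ↦ b γ * exp (I * u * γ) with hg
  have hgnorm (γ : ℝ) : ‖g γ‖ = ‖b γ‖ := by
    have : I * u * γ = ((u * γ : ℝ) : ℂ) * I := by push_cast; ring
    rw [hg, norm_mul, this, norm_exp_ofReal_mul_I, mul_one]
  set f : ℝ → ℂ := fun y ↦ ∑ γ ∈ F, g γ * exp (I * y * γ) with hf
  have hshift : ∫ y in u..u + 1, ‖∑ γ ∈ F, b γ * exp (I * y * γ)‖ ^ 2 =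
      ∫ y in (0 : ℝ)..1, ‖f y‖ ^ 2 := by
    have := intervalIntegral.integral_comp_add_right (a := 0) (b := 1)
      (fun y : ℝ ↦ ‖∑ γ ∈ F, b γ * exp (I * y * γ)‖ ^ 2) u
    rw [zero_add, add_comm 1 u] at this
    rw [← this]
    refine intervalIntegral.integral_congr fun y _ ↦ ?_
    simp only [hf, hg, mul_assoc, ← Complex.exp_add]
    push_cast
    ring_nf
  have hexpand (y : ℝ) : ((Real.exp (-|y|) * ‖f y‖ ^ 2 : ℝ) : ℂ) = ∑ γ ∈ F, ∑ γ' ∈ F,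
      g γ * conj (g γ') * ((Real.exp (-|y|) : ℂ) * exp (I * y * (γ - γ' : ℝ))) := by
    have h1 : ((‖f y‖ ^ 2 : ℝ) : ℂ) = f y * conj (f y) := by
      rw [mul_conj, normSq_eq_norm_sq]
    have h2 (γ : ℝ) : conj (exp (I * y * γ)) = exp (-(I * y * γ)) := by
      rw [← exp_conj]
      simp
    rw [ofReal_mul, h1, hf, map_sum, Finset.sum_mul_sum, Finset.mul_sum]
    refine Finset.sum_congr rfl fun γ _ ↦ ?_
    rw [Finset.mul_sum]
    refine Finset.sum_congr rfl fun γ' _ ↦ ?_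
    have h3 : I * y * ((γ - γ' : ℝ) : ℂ) = I * y * γ + -(I * y * γ') := by push_cast; ring
    rw [map_mul, h2, h3, Complex.exp_add]
    ring
  have hinteg (γ γ' : ℝ) : Integrable fun y : ℝ ↦
      g γ * conj (g γ') * ((Real.exp (-|y|) : ℂ) * exp (I * y * (γ - γ' : ℝ))) :=
    (integrable_exp_neg_abs_mul_exp _).1.const_mul _
  have hinteg' : Integrable fun y : ℝ ↦ ((Real.exp (-|y|) * ‖f y‖ ^ 2 : ℝ) : ℂ) := by
    simp only [hexpand]
    exact integrable_finsetSum _ fun γ _ ↦ integrable_finsetSum _ fun γ' _ ↦ hinteg γ γ'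
  have hintR : Integrable fun y : ℝ ↦ Real.exp (-|y|) * ‖f y‖ ^ 2 := by
    simpa only [RCLike.re_to_complex, ofReal_re] using hinteg'.re
  have hcont : Continuous f := by
    rw [hf]
    fun_prop
  have hwhole : ∫ y : ℝ, Real.exp (-|y|) * ‖f y‖ ^ 2 ≤
      ∑ γ ∈ F, ∑ γ' ∈ F, ‖b γ‖ * ‖b γ'‖ * (2 / (1 + (γ - γ') ^ 2)) := by
    have h1 : ((∫ y : ℝ, Real.exp (-|y|) * ‖f y‖ ^ 2 : ℝ) : ℂ) =
        ∑ γ ∈ F, ∑ γ' ∈ F, g γ * conj (g γ') * (2 / (1 + (γ - γ' : ℝ) ^ 2)) := by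
      rw [← integral_complex_ofReal]
      simp only [hexpand]
      rw [integral_finsetSum _ fun γ _ ↦ integrable_finsetSum _ fun γ' _ ↦ hinteg γ γ']
      refine Finset.sum_congr rfl fun γ _ ↦ ?_
      rw [integral_finsetSum _ fun γ' _ ↦ hinteg γ γ']
      refine Finset.sum_congr rfl fun γ' _ ↦ ?_
      rw [integral_const_mul, (integrable_exp_neg_abs_mul_exp _).2]
    refine (Complex.re_le_norm _).trans' (ofReal_re _).ge |>.trans ?_
    rw [h1]
    refine (norm_sum_le _ _).trans (Finset.sum_le_sum fun γ _ ↦ ?_)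
    refine (norm_sum_le _ _).trans (Finset.sum_le_sum fun γ' _ ↦ ?_)
    have h2 : (2 / (1 + ((γ - γ' : ℝ) : ℂ) ^ 2)) = ((2 / (1 + (γ - γ') ^ 2) : ℝ) : ℂ) := by
      push_cast
      rfl
    rw [norm_mul, norm_mul, RCLike.norm_conj, hgnorm, hgnorm, h2, norm_real, Real.norm_of_nonneg
      (by positivity)]
  have hschur : ∑ γ ∈ F, ∑ γ' ∈ F, ‖b γ‖ * ‖b γ'‖ * (2 / (1 + (γ - γ') ^ 2)) ≤
      2 * ∑ γ ∈ F, ‖b γ‖ ^ 2 * ∑ γ' ∈ F, 1 / (1 + (γ - γ') ^ 2) := by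
    have h1 : ∑ γ ∈ F, ∑ γ' ∈ F, ‖b γ'‖ ^ 2 * (1 / (1 + (γ - γ') ^ 2)) =
        ∑ γ ∈ F, ∑ γ' ∈ F, ‖b γ‖ ^ 2 * (1 / (1 + (γ - γ') ^ 2)) := by
      rw [Finset.sum_comm]
      refine Finset.sum_congr rfl fun γ _ ↦ Finset.sum_congr rfl fun γ' _ ↦ ?_
      rw [← neg_sub, neg_sq]
    calc _ ≤ ∑ γ ∈ F, ∑ γ' ∈ F, (‖b γ‖ ^ 2 * (1 / (1 + (γ - γ') ^ 2)) +
          ‖b γ'‖ ^ 2 * (1 / (1 + (γ - γ') ^ 2))) := by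
          refine Finset.sum_le_sum fun γ _ ↦ Finset.sum_le_sum fun γ' _ ↦ ?_
          rw [← add_mul, show (2 : ℝ) / (1 + (γ - γ') ^ 2) = 2 * (1 / (1 + (γ - γ') ^ 2)) by ring,
            ← mul_assoc]
          gcongr
          nlinarith [sq_nonneg (‖b γ‖ - ‖b γ'‖)]
      _ = _ := by
          simp only [Finset.sum_add_distrib]
          rw [h1, ← two_mul]
          simp only [Finset.mul_sum]
  rw [hshift, mul_assoc, mul_left_comm]
  calc ∫ y in (0 : ℝ)..1, ‖f y‖ ^ 2
      ≤ ∫ y in (0 : ℝ)..1, Real.exp 1 * (Real.exp (-|y|) * ‖f y‖ ^ 2) := by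
        refine intervalIntegral.integral_mono_on zero_le_one ?_ ?_ fun y hy ↦ ?_
        · exact (by fun_prop : Continuous fun y ↦ ‖f y‖ ^ 2).intervalIntegrable _ _
        · exact (by fun_prop : Continuous fun y ↦ Real.exp 1 * (Real.exp (-|y|) * ‖f y‖ ^ 2))
            |>.intervalIntegrable _ _
        · rw [← mul_assoc, ← Real.exp_add]
          refine le_mul_of_one_le_left (by positivity) (Real.one_le_exp ?_)
          rw [abs_of_nonneg hy.1]
          linarith [hy.2]
    _ = Real.exp 1 * ∫ y in (0 : ℝ)..1, Real.exp (-|y|) * ‖f y‖ ^ 2 :=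
        intervalIntegral.integral_const_mul _ _
    _ ≤ Real.exp 1 * ∫ y : ℝ, Real.exp (-|y|) * ‖f y‖ ^ 2 := by
        gcongr
        rw [intervalIntegral.integral_of_le zero_le_one]
        exact setIntegral_le_integral hintR (.of_forall fun y ↦ by positivity)
    _ ≤ _ := by
        gcongr
        exact hwhole.trans hschur

theorem one_div_one_add_sq_le (x : ℝ) : 1 / (1 + x ^ 2) ≤ 2 * (1 + |x|) ^ (-(1 + 1 : ℝ)) := by
  rw [Real.rpow_neg (by positivity), show (1 + 1 : ℝ) = (2 : ℕ) by norm_num, Real.rpow_natCast,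
    ← div_eq_mul_inv, div_le_div_iff₀ (by positivity) (by positivity)]
  nlinarith [sq_nonneg (1 - |x|), sq_abs x]

/-- Mean square of exponential polynomials with frequencies in `Z`, all at least `V`. -/
theorem exists_integral_norm_sq_le {Z : Set ℝ} {a : ℝ → ℂ} {K A η : ℝ} (hK : 0 < K) (hA : 0 < A)
    (hη : 0 < η) (hη' : 5 * η ≤ 1)
    (hcount : ∀ (t : ℝ) (F : Finset ℝ), (∀ γ ∈ F, γ ∈ Z ∧ |γ - t| ≤ 1 / 2) →
      (F.card : ℝ) ≤ K * (1 + Real.log (1 + |t|)))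
    (ha : ∀ γ ∈ Z, ‖a γ‖ ≤ A * (1 + |γ|) ^ (-1 + η)) :
    ∃ K' : ℝ, 0 < K' ∧ ∀ V : ℝ, 1 ≤ V → ∀ F : Finset ℝ, (∀ γ ∈ F, γ ∈ Z ∧ V ≤ |γ|) → ∀ u : ℝ,
      ∫ y in u..u + 1, ‖∑ γ ∈ F, a γ * exp (I * y * γ)‖ ^ 2 ≤ K' * V ^ (-1 + 5 * η) := by
  obtain ⟨K₁, hK₁, h₁⟩ := exists_sum_rpow_sub_le hK hcount (η := η) (σ := 2 * η) hη (by linarith)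
  obtain ⟨K₂, hK₂, h₂⟩ := exists_sum_rpow_sub_le hK hcount (η := η) (σ := 1) hη (by linarith)
  refine ⟨2 * Real.exp 1 * (A ^ 2 * (2 * K₂) * K₁), by positivity, fun V hV F hF u ↦ ?_⟩
  refine (integral_norm_sq_sum_exp_le F a u).trans ?_
  rw [mul_assoc _ (A ^ 2 * (2 * K₂) * K₁)]
  refine mul_le_mul_of_nonneg_left ?_ (by positivity)
  have hterm : ∀ γ ∈ F, ‖a γ‖ ^ 2 * ∑ γ' ∈ F, 1 / (1 + (γ - γ') ^ 2) ≤
      A ^ 2 * (2 * K₂) * V ^ (-1 + 5 * η) * (1 + |γ - 0|) ^ (-(1 + 2 * η)) := by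
    intro γ hγ
    have hs : ∑ γ' ∈ F, 1 / (1 + (γ - γ') ^ 2) ≤ 2 * (K₂ * (1 + |γ|) ^ η) := by
      calc _ ≤ ∑ γ' ∈ F, 2 * (1 + |γ' - γ|) ^ (-(1 + 1 : ℝ)) := Finset.sum_le_sum fun γ' _ ↦ by
            rw [abs_sub_comm]
            exact one_div_one_add_sq_le _
        _ ≤ _ := by
            rw [← Finset.mul_sum]
            gcongr
            exact h₂ γ F fun γ' hγ' ↦ (hF γ' hγ').1
    have h0 : 0 < 1 + |γ| := by positivity
    have hpow : (1 + |γ|) ^ (-1 + η) * (1 + |γ|) ^ (-1 + η) * (1 + |γ|) ^ η =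
        (1 + |γ|) ^ (-1 + 5 * η) * (1 + |γ|) ^ (-(1 + 2 * η)) := by
      rw [← Real.rpow_add h0, ← Real.rpow_add h0, ← Real.rpow_add h0]
      ring_nf
    have hV' : (1 + |γ|) ^ (-1 + 5 * η) ≤ V ^ (-1 + 5 * η) :=
      Real.rpow_le_rpow_of_nonpos (by linarith) (by linarith [(hF γ hγ).2]) (by linarith)
    calc _ ≤ (A * (1 + |γ|) ^ (-1 + η)) ^ 2 * (2 * (K₂ * (1 + |γ|) ^ η)) := by
          gcongr
          exact ha γ (hF γ hγ).1
      _ = A ^ 2 * (2 * K₂) * ((1 + |γ|) ^ (-1 + η) * (1 + |γ|) ^ (-1 + η) * (1 + |γ|) ^ η) := by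
          ring
      _ = A ^ 2 * (2 * K₂) * (1 + |γ|) ^ (-1 + 5 * η) * (1 + |γ|) ^ (-(1 + 2 * η)) := by
          rw [hpow, ← mul_assoc]
      _ ≤ _ := by
          rw [sub_zero]
          gcongr
  refine (Finset.sum_le_sum hterm).trans ?_
  rw [← Finset.mul_sum]
  have h := h₁ 0 F fun γ hγ ↦ (hF γ hγ).1
  rw [abs_zero, add_zero, Real.one_rpow, mul_one] at h
  calc _ ≤ A ^ 2 * (2 * K₂) * V ^ (-1 + 5 * η) * K₁ := by gcongr
    _ = _ := by ring

/-- A trivial bound for exponential sums over short windows of frequencies. -/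
theorem exists_norm_sum_window_le {Z : Set ℝ} {a : ℝ → ℂ} {K A η : ℝ} (hK : 0 < K) (hA : 0 < A)
    (hη : 0 < η) (hη' : 2 * η ≤ 1)
    (hcount : ∀ (t : ℝ) (F : Finset ℝ), (∀ γ ∈ F, γ ∈ Z ∧ |γ - t| ≤ 1 / 2) →
      (F.card : ℝ) ≤ K * (1 + Real.log (1 + |t|)))
    (ha : ∀ γ ∈ Z, ‖a γ‖ ≤ A * (1 + |γ|) ^ (-1 + η)) :
    ∃ K' : ℝ, 0 < K' ∧ ∀ W h : ℝ, 0 < W → 1 ≤ h → ∀ F : Finset ℝ,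
      (∀ γ ∈ F, γ ∈ Z ∧ W < |γ| ∧ |γ| ≤ W + h) → ∀ y : ℝ,
      ‖∑ γ ∈ F, a γ * exp (I * y * γ)‖ ≤ K' * h ^ 2 * W ^ (-1 + 2 * η) := by
  obtain ⟨K₂, hK₂, h₂⟩ := exists_sum_rpow_sub_le hK hcount (η := η) (σ := 1) hη (by linarith)
  refine ⟨8 * K₂ * A, by positivity, fun W h hW hh F hF y ↦ ?_⟩
  have hcard : (F.card : ℝ) ≤ 8 * K₂ * h ^ 2 * (1 + W) ^ η := by
    have hlow : ∀ γ ∈ F, (1 + h) ^ (-(1 + 1 : ℝ)) ≤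
        (1 + |γ - W|) ^ (-(1 + 1 : ℝ)) + (1 + |γ - -W|) ^ (-(1 + 1 : ℝ)) := by
      intro γ hγ
      obtain ⟨-, h1, h2⟩ := hF γ hγ
      rcases abs_cases γ with ⟨h3, -⟩ | ⟨h3, -⟩
      · refine le_add_of_le_of_nonneg (Real.rpow_le_rpow_of_nonpos (by positivity) ?_
          (by norm_num)) (by positivity)
        gcongr
        exact abs_le.mpr ⟨by linarith, by linarith⟩
      · refine le_add_of_nonneg_of_le (by positivity) (Real.rpow_le_rpow_of_nonpos
          (by positivity) ?_ (by norm_num))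
        gcongr
        exact abs_le.mpr ⟨by linarith, by linarith⟩
    have hsum := Finset.card_nsmul_le_sum F _ _ hlow
    rw [Finset.sum_add_distrib, nsmul_eq_mul] at hsum
    have e1 := h₂ W F fun γ hγ ↦ (hF γ hγ).1
    have e2 := h₂ (-W) F fun γ hγ ↦ (hF γ hγ).1
    rw [abs_neg] at e2
    rw [abs_of_pos hW] at e1 e2
    rw [Real.rpow_neg (by positivity), show (1 + 1 : ℝ) = (2 : ℕ) by norm_num, Real.rpow_natCast,
      ← div_eq_mul_inv, div_le_iff₀ (by positivity)] at hsum
    push_cast at hsum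
    calc (F.card : ℝ) ≤ _ := hsum
      _ ≤ (K₂ * (1 + W) ^ η + K₂ * (1 + W) ^ η) * (h + h) ^ 2 := by
        norm_num at e1 e2 ⊢
        gcongr
      _ = _ := by ring
  have hterm : ∀ γ ∈ F, ‖a γ * exp (I * y * γ)‖ ≤ A * (1 + W) ^ (-1 + η) := by
    intro γ hγ
    have h1 : I * y * γ = ((y * γ : ℝ) : ℂ) * I := by push_cast; ring
    rw [norm_mul, h1, norm_exp_ofReal_mul_I, mul_one]
    refine (ha γ (hF γ hγ).1).trans ?_
    exact mul_le_mul_of_nonneg_left (Real.rpow_le_rpow_of_nonpos (by positivity)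
      (by linarith [(hF γ hγ).2.1]) (by linarith)) hA.le
  calc _ ≤ ∑ γ ∈ F, ‖a γ * exp (I * y * γ)‖ := norm_sum_le _ _
    _ ≤ F.card • (A * (1 + W) ^ (-1 + η)) := Finset.sum_le_card_nsmul _ _ _ hterm
    _ ≤ 8 * K₂ * h ^ 2 * (1 + W) ^ η * (A * (1 + W) ^ (-1 + η)) := by
      rw [nsmul_eq_mul]
      gcongr
    _ = 8 * K₂ * A * h ^ 2 * (1 + W) ^ (-1 + 2 * η) := by
      rw [show -1 + 2 * η = η + (-1 + η) by ring, Real.rpow_add (by positivity) η]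
      ring
    _ ≤ _ := by
      refine mul_le_mul_of_nonneg_left ?_ (by positivity)
      exact Real.rpow_le_rpow_of_nonpos hW (by linarith) (by linarith)

theorem norm_add_add_sq_le (x y z : ℂ) :
    ‖x + y + z‖ ^ 2 ≤ 3 * (‖x‖ ^ 2 + ‖y‖ ^ 2 + ‖z‖ ^ 2) := by
  have h : ‖x + y + z‖ ≤ ‖x‖ + ‖y‖ + ‖z‖ := norm_add₃_le
  calc _ ≤ (‖x‖ + ‖y‖ + ‖z‖) ^ 2 := by gcongr
    _ ≤ _ := by
      nlinarith [sq_nonneg (‖x‖ - ‖y‖), sq_nonneg (‖x‖ - ‖z‖), sq_nonneg (‖y‖ - ‖z‖)]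

/-- On a unit interval, the exponential sums over `T₀ < |γ| ≤ τ` with `A ≤ τ ≤ B` are dominated,
uniformly in `τ`, by a function with small integral. -/
theorem exists_dominating_function {Z : Set ℝ} {a : ℝ → ℂ} {K L η ε : ℝ} (hK : 0 < K) (hL : 0 < L)
    (hη : 0 < η) (hη' : 5 * η ≤ 1 / 24) (hηε : 5 * η ≤ ε)
    (hcount : ∀ (t : ℝ) (F : Finset ℝ), (∀ γ ∈ F, γ ∈ Z ∧ |γ - t| ≤ 1 / 2) →
      (F.card : ℝ) ≤ K * (1 + Real.log (1 + |t|)))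
    (ha : ∀ γ ∈ Z, ‖a γ‖ ≤ L * (1 + |γ|) ^ (-1 + η))
    {Φ : ℝ → ℝ → Finset ℝ} (hΦ : ∀ v w γ, γ ∈ Φ v w ↔ γ ∈ Z ∧ v < |γ| ∧ |γ| ≤ w) :
    ∃ C : ℝ, 0 < C ∧ ∀ T₀ A B : ℝ, 1 ≤ T₀ → 1 ≤ A → 0 ≤ B → B ≤ 30 * A ^ (5 / 4 : ℝ) → ∀ u : ℝ,
      ∃ G : ℝ → ℝ, Continuous G ∧ (∀ y, 0 ≤ G y) ∧
        ∫ y in u..u + 1, G y ≤ C * (T₀ ^ (-1 + ε) + A ^ (-(1 / 24) : ℝ)) ∧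
        ∀ y τ : ℝ, A ≤ τ → τ ≤ B → ‖∑ γ ∈ Φ T₀ τ, a γ * exp (I * y * γ)‖ ^ 2 ≤ G y := by
  obtain ⟨K₁, hK₁, h₁⟩ := exists_integral_norm_sq_le hK hL hη (by linarith) hcount ha
  obtain ⟨K₂, hK₂, h₂⟩ := exists_norm_sum_window_le hK hL hη (by linarith) hcount ha
  refine ⟨3 * (32 * K₁ + K₂ ^ 2), by positivity, fun T₀ A B hT₀ hA hB0 hB u ↦ ?_⟩
  have hA0 : 0 < A := by linarith
  set M := max T₀ A with hM
  have hMT : T₀ ≤ M := le_max_left _ _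
  have hMA : A ≤ M := le_max_right _ _
  have hM0 : 0 < M := by linarith
  set h := A ^ (1 / 3 : ℝ) with hh
  have hh1 : 1 ≤ h := Real.one_le_rpow hA (by norm_num)
  have hh0 : 0 < h := by linarith
  set J := ⌊B / h⌋₊ with hJ
  set S : ℝ → ℝ → ℝ → ℂ := fun v w y ↦ ∑ γ ∈ Φ v w, a γ * exp (I * y * γ) with hS
  have hScont (v w : ℝ) : Continuous (S v w) := by
    rw [hS]
    fun_prop
  have hSint (v w : ℝ) : IntervalIntegrable (fun y ↦ ‖S v w y‖ ^ 2) volume u (u + 1) :=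
    (by fun_prop : Continuous fun y ↦ ‖S v w y‖ ^ 2).intervalIntegrable _ _
  have hSle (v w : ℝ) (hv : 1 ≤ v) : ∫ y in u..u + 1, ‖S v w y‖ ^ 2 ≤ K₁ * v ^ (-1 + 5 * η) :=
    h₁ v hv (Φ v w) (fun γ hγ ↦ ⟨((hΦ _ _ _).mp hγ).1, ((hΦ _ _ _).mp hγ).2.1.le⟩) u
  have hsplit (v w x y : ℝ) (hvw : v ≤ w) (hwx : w ≤ x) : S v x y = S v w y + S w x y := by
    rw [hS]
    have hdisj : Disjoint (Φ v w) (Φ w x) := Finset.disjoint_left.mpr fun γ h1 h2 ↦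
      absurd ((hΦ _ _ _).mp h1).2.2 (not_le.mpr ((hΦ _ _ _).mp h2).2.1)
    have hun : Φ v x = Φ v w ∪ Φ w x := by
      ext γ
      rw [Finset.mem_union, hΦ, hΦ, hΦ]
      constructor
      · rintro ⟨h1, h2, h3⟩
        rcases le_or_gt |γ| w with h4 | h4
        · exact .inl ⟨h1, h2, h4⟩
        · exact .inr ⟨h1, h4, h3⟩
      · rintro (⟨h1, h2, h3⟩ | ⟨h1, h2, h3⟩)
        · exact ⟨h1, h2, h3.trans hwx⟩
        · exact ⟨h1, hvw.trans_lt h2, h3⟩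
    simp only [hun, Finset.sum_union hdisj]
  set R := K₂ * h ^ 2 * M ^ (-1 + 2 * η) with hR
  refine ⟨fun y ↦ 3 * (‖S T₀ M y‖ ^ 2 + ∑ j ∈ Finset.range (J + 1), ‖S M (M + j * h) y‖ ^ 2 +
    R ^ 2), by fun_prop, fun y ↦ by positivity, ?_, fun y τ hτA hτB ↦ ?_⟩
  · have hsumint : IntervalIntegrable
        (fun y ↦ ∑ j ∈ Finset.range (J + 1), ‖S M (M + j * h) y‖ ^ 2) volume u (u + 1) :=
      (by fun_prop : Continuous fun y ↦ ∑ j ∈ Finset.range (J + 1), ‖S M (M + j * h) y‖ ^ 2)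
        |>.intervalIntegrable _ _
    rw [intervalIntegral.integral_const_mul, intervalIntegral.integral_add
      ((hSint _ _).add hsumint) intervalIntegrable_const, intervalIntegral.integral_add
      (hSint _ _) hsumint, intervalIntegral.integral_finsetSum fun j _ ↦ hSint _ _,
      intervalIntegral.integral_const, add_sub_cancel_left, one_smul, mul_assoc 3]
    have hMpow : M ^ (-1 + 5 * η) ≤ A ^ (-1 + 5 * η) :=
      Real.rpow_le_rpow_of_nonpos hA0 hMA (by linarith)
    have hJ' : ((J + 1 : ℕ) : ℝ) ≤ 31 * A ^ (11 / 12 : ℝ) := by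
      have e1 : (J : ℝ) ≤ B / h := Nat.floor_le (by positivity)
      have e2 : B / h ≤ 30 * A ^ (11 / 12 : ℝ) := by
        rw [div_le_iff₀ hh0, hh, mul_assoc, ← Real.rpow_add hA0]
        norm_num at hB ⊢
        exact hB
      have e3 : 1 ≤ A ^ (11 / 12 : ℝ) := Real.one_le_rpow hA (by norm_num)
      push_cast
      linarith
    have i1 : ∫ y in u..u + 1, ‖S T₀ M y‖ ^ 2 ≤ K₁ * T₀ ^ (-1 + ε) := by
      refine (hSle T₀ M hT₀).trans ?_
      gcongr
    have i2 : ∑ j ∈ Finset.range (J + 1), ∫ y in u..u + 1, ‖S M (M + j * h) y‖ ^ 2 ≤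
        31 * K₁ * A ^ (-(1 / 24) : ℝ) := by
      refine (Finset.sum_le_card_nsmul _ _ _ fun j _ ↦ (hSle M _ (by linarith)).trans
        (mul_le_mul_of_nonneg_left hMpow hK₁.le)).trans ?_
      rw [Finset.card_range, nsmul_eq_mul]
      calc _ ≤ 31 * A ^ (11 / 12 : ℝ) * (K₁ * A ^ (-1 + 5 * η)) := by gcongr
        _ = 31 * K₁ * A ^ (11 / 12 + (-1 + 5 * η)) := by
          rw [Real.rpow_add hA0 (11 / 12)]
          ring
        _ ≤ _ := by
          gcongr
          linarith
    have i3 : R ^ 2 ≤ K₂ ^ 2 * A ^ (-(1 / 24) : ℝ) := by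
      have e1 : M ^ (-1 + 2 * η) ≤ A ^ (-1 + 2 * η) :=
        Real.rpow_le_rpow_of_nonpos hA0 hMA (by linarith)
      have e2 : h ^ 2 * A ^ (-1 + 2 * η) = A ^ (-(1 / 3) + 2 * η) := by
        rw [hh, ← Real.rpow_natCast, ← Real.rpow_mul hA0.le, ← Real.rpow_add hA0]
        congr 1
        push_cast
        ring
      have e3 : R ≤ K₂ * A ^ (-(1 / 3) + 2 * η) := by
        rw [hR, ← e2, ← mul_assoc]
        gcongr
      calc R ^ 2 ≤ (K₂ * A ^ (-(1 / 3) + 2 * η)) ^ 2 := by gcongr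
        _ = K₂ ^ 2 * A ^ (2 * (-(1 / 3) + 2 * η)) := by
          rw [mul_pow, ← Real.rpow_natCast (A ^ _), ← Real.rpow_mul hA0.le]
          push_cast
          ring_nf
        _ ≤ _ := by
          gcongr
          linarith
    have p1 : 0 < T₀ ^ (-1 + ε) := by positivity
    have p2 : 0 < A ^ (-(1 / 24) : ℝ) := by positivity
    nlinarith [mul_pos hK₁ p1, mul_pos hK₁ p2, mul_pos (pow_pos hK₂ 2) p1]
  · change ‖S T₀ τ y‖ ^ 2 ≤ _
    beta_reduce
    rcases le_or_gt τ T₀ with hτ | hτ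
    · have : Φ T₀ τ = ∅ := by
        ext γ
        rw [hΦ]
        simp only [Finset.notMem_empty, iff_false]
        rintro ⟨-, h1, h2⟩
        linarith
      have h0 : S T₀ τ y = 0 := by simp [hS, this]
      rw [h0, norm_zero, zero_pow two_ne_zero]
      positivity
    · have hMτ : M ≤ τ := max_le hτ.le hτA
      set j := ⌊(τ - M) / h⌋₊ with hj
      have hj1 : j * h ≤ τ - M := by
        rw [← le_div_iff₀ hh0]
        exact Nat.floor_le (div_nonneg (by linarith) hh0.le)
      have hj2 : τ - M < (j + 1) * h := by
        rw [← div_lt_iff₀ hh0]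
        exact Nat.lt_floor_add_one _
      have hjJ : j ∈ Finset.range (J + 1) := by
        rw [Finset.mem_range, Nat.lt_succ_iff]
        refine Nat.floor_le_floor ?_
        gcongr
        linarith
      have hjh : 0 ≤ j * h := by positivity
      rw [hsplit T₀ (M + j * h) τ y (by linarith) (by linarith),
        hsplit T₀ M (M + j * h) y hMT (by linarith)]
      refine (norm_add_add_sq_le _ _ _).trans ?_
      gcongr
      · exact Finset.single_le_sum (f := fun j : ℕ ↦ ‖S M (M + j * h) y‖ ^ 2)
          (fun i _ ↦ by positivity) hjJ
      · refine (h₂ (M + j * h) h (by linarith) hh1 _ (fun γ hγ ↦ ?_) y).trans ?_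
        · obtain ⟨g1, g2, g3⟩ := (hΦ _ _ _).mp hγ
          exact ⟨g1, g2, by linarith⟩
        · rw [hR]
          exact mul_le_mul_of_nonneg_left
            (Real.rpow_le_rpow_of_nonpos hM0 (by linarith) (by linarith)) (by positivity)

/-- Integrals over `[2, Y]` from dominating functions on unit intervals. -/
theorem integral_le_of_dominated_on_unit_intervals {F : ℝ → ℝ} (hF : ∀ y, 0 ≤ F y) {E D r : ℝ}
    (hE : 0 ≤ E) (hD : 0 ≤ D) (hr0 : 0 ≤ r) (hr1 : r < 1)
    (h : ∀ k : ℕ, 2 ≤ k → ∃ G : ℝ → ℝ, Continuous G ∧ (∀ y, 0 ≤ G y) ∧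
      ∫ y in (k : ℝ)..k + 1, G y ≤ E + D * r ^ k ∧ ∀ y : ℝ, k ≤ y → y ≤ k + 1 → F y ≤ G y)
    {Y : ℝ} (hY : 2 ≤ Y) :
    ∫ y in (2 : ℝ)..Y, F y ≤ Y * E + D / (1 - r) := by
  choose! G hGc hG0 hGint hFG using h
  set N := ⌊Y⌋₊ with hN
  have hNY : (N : ℝ) ≤ Y := Nat.floor_le (by linarith)
  set g : ℕ → ℝ → ℝ := fun k ↦ (Set.Ico (k : ℝ) (k + 1)).indicator (G k) with hg
  have hk2 : ∀ k ∈ Finset.Icc 2 N, 2 ≤ k := fun k hk ↦ (Finset.mem_Icc.mp hk).1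
  have hgint : ∀ k ∈ Finset.Icc 2 N, Integrable (g k) := fun k hk ↦ by
    rw [hg, integrable_indicator_iff measurableSet_Ico]
    exact ((hGc k (hk2 k hk)).integrableOn_Icc).mono_set Set.Ico_subset_Icc_self
  have hg0 : ∀ k ∈ Finset.Icc 2 N, ∀ y, 0 ≤ g k y := fun k hk y ↦
    Set.indicator_nonneg (fun z _ ↦ hG0 k (hk2 k hk) z) y
  rw [intervalIntegral.integral_of_le hY]
  calc ∫ y in Set.Ioc 2 Y, F y ≤ ∫ y in Set.Ioc 2 Y, ∑ k ∈ Finset.Icc 2 N, g k y := by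
        refine integral_mono_of_nonneg (.of_forall hF)
          (integrable_finsetSum _ fun k hk ↦ (hgint k hk).integrableOn) ?_
        refine (ae_restrict_iff' measurableSet_Ioc).mpr (.of_forall fun y hy ↦ ?_)
        have hy2 : (2 : ℝ) ≤ y := hy.1.le
        have hk : ⌊y⌋₊ ∈ Finset.Icc 2 N :=
          Finset.mem_Icc.mpr ⟨Nat.le_floor (by exact_mod_cast hy2), Nat.floor_le_floor hy.2⟩
        have h1 : (⌊y⌋₊ : ℝ) ≤ y := Nat.floor_le (by linarith)
        have h2 : y < ⌊y⌋₊ + 1 := Nat.lt_floor_add_one y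
        refine le_trans ?_ (Finset.single_le_sum (fun k hk ↦ hg0 k hk y) hk)
        have hmem : y ∈ Set.Ico (⌊y⌋₊ : ℝ) (⌊y⌋₊ + 1) := ⟨h1, h2⟩
        exact (hFG _ (hk2 _ hk) y h1 h2.le).trans_eq (Set.indicator_of_mem hmem _).symm
    _ = ∑ k ∈ Finset.Icc 2 N, ∫ y in Set.Ioc 2 Y, g k y :=
        integral_finsetSum _ fun k hk ↦ (hgint k hk).integrableOn
    _ ≤ ∑ k ∈ Finset.Icc 2 N, (E + D * r ^ k) := by
        refine Finset.sum_le_sum fun k hk ↦ ?_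
        refine (setIntegral_le_integral (hgint k hk) (.of_forall (hg0 k hk))).trans ?_
        rw [hg, integral_indicator measurableSet_Ico, integral_Ico_eq_integral_Ioc,
          ← intervalIntegral.integral_of_le (by linarith)]
        exact hGint k (hk2 k hk)
    _ = (Finset.Icc 2 N).card * E + D * ∑ k ∈ Finset.Icc 2 N, r ^ k := by
        rw [Finset.sum_add_distrib, Finset.sum_const, nsmul_eq_mul, Finset.mul_sum]
    _ ≤ Y * E + D * (1 - r)⁻¹ := by
        have h1 : ((Finset.Icc 2 N).card : ℝ) ≤ Y := by
          refine le_trans ?_ hNY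
          rw [Nat.card_Icc]
          exact_mod_cast by omega
        have h2 : ∑ k ∈ Finset.Icc 2 N, r ^ k ≤ (1 - r)⁻¹ := by
          rw [← tsum_geometric_of_lt_one hr0 hr1]
          exact (summable_geometric_of_lt_one hr0 hr1).sum_le_tsum _ fun k _ ↦ by positivity
        gcongr
    _ = _ := by rw [div_eq_mul_inv]

theorem finite_setOf_mem_abs_le {Z : Set ℝ} {K : ℝ} (hK : 0 < K)
    (hcount : ∀ (t : ℝ) (F : Finset ℝ), (∀ γ ∈ F, γ ∈ Z ∧ |γ - t| ≤ 1 / 2) →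
      (F.card : ℝ) ≤ K * (1 + Real.log (1 + |t|))) (w : ℝ) :
    {γ | γ ∈ Z ∧ |γ| ≤ w}.Finite := by
  obtain ⟨K', hK', h⟩ := exists_sum_rpow_sub_le hK hcount one_half_pos one_half_lt_one
  by_contra hinf
  rw [Set.not_finite] at hinf
  obtain ⟨γ₀, hγ₀⟩ := hinf.nonempty
  have hw : 0 ≤ w := (abs_nonneg γ₀).trans hγ₀.2
  obtain ⟨n, hn⟩ := exists_nat_gt (K' / (1 + w) ^ (-(1 + 1 : ℝ)))
  rw [div_lt_iff₀ (by positivity)] at hn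
  obtain ⟨F, hF, rfl⟩ := hinf.exists_subset_card_eq n
  have h1 := h 0 F fun γ hγ ↦ (hF hγ).1
  rw [abs_zero, add_zero, Real.one_rpow, mul_one] at h1
  have h2 := Finset.card_nsmul_le_sum F (fun γ ↦ (1 + |γ - 0|) ^ (-(1 + 1 : ℝ)))
    ((1 + w) ^ (-(1 + 1 : ℝ))) fun γ hγ ↦ by
      rw [sub_zero]
      exact Real.rpow_le_rpow_of_nonpos (by positivity) (by linarith [(hF hγ).2]) (by norm_num)
  rw [nsmul_eq_mul] at h2
  linarith

theorem one_add_abs_le_norm_half_add (γ : ℝ) : (1 + |γ|) / 4 ≤ ‖(1 / 2 + I * γ : ℂ)‖ := by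
  have h1 := abs_re_le_norm (1 / 2 + I * γ : ℂ)
  have h2 := abs_im_le_norm (1 / 2 + I * γ : ℂ)
  have e1 : (1 / 2 + I * γ : ℂ).re = 1 / 2 := by simp
  have e2 : (1 / 2 + I * γ : ℂ).im = γ := by simp
  rw [e1, abs_of_pos (by norm_num)] at h1
  rw [e2] at h2
  linarith

/-- Mean-square bound for the tail of the zero sum: under GRH and `L(1/2,χ) ≠ 0`,
with `S(x,T₀;χ) = ∑_{T₀ < |γ| ≤ T(x)} L'(ρ,χ) x^{iγ}/(1/2+iγ)` and
`x^{2/3}/2 ≤ T(x) ≤ 2 x^{5/6}`, one has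
`∫_2^Y |S(e^y,T₀;χ)|² dy ≪_ε Y/T₀^{1−ε} + (log Y)/T₀^{1−ε} + T₀^ε`. -/
theorem tail_zero_sum_mean_square {q : ℕ} [NeZero q] (χ : DirichletCharacter ℂ q)
    (hχ : χ ≠ 1)
    (hGRH : ∀ s : ℂ, DirichletCharacter.LFunction χ s = 0 → 0 < s.re → s.re < 1 →
      s.re = 1 / 2)
    (hhalf : DirichletCharacter.LFunction χ (1 / 2) ≠ 0) :
    ∀ ε : ℝ, 0 < ε → ∃ C : ℝ, 0 < C ∧
      ∀ T₀ : ℝ, 2 ≤ T₀ → ∀ T : ℝ → ℝ,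
        (∀ x : ℝ, 2 ≤ x → x ^ ((2 : ℝ) / 3) / 2 ≤ T x ∧ T x ≤ 2 * x ^ ((5 : ℝ) / 6)) →
        ∀ Y : ℝ, 2 ≤ Y →
        (∫ y in (2:ℝ)..Y,
          ‖∑' ρ : {ρ : ℂ // DirichletCharacter.LFunction χ ρ = 0 ∧ 0 < ρ.re ∧
              ρ.re < 1 ∧ T₀ < |ρ.im| ∧ |ρ.im| ≤ T (Real.exp y)},
            deriv (DirichletCharacter.LFunction χ) (ρ : ℂ) *
              (Real.exp y : ℂ) ^ (Complex.I * (ρ : ℂ).im) /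
              (1 / 2 + Complex.I * (ρ : ℂ).im)‖ ^ 2) ≤
        C * (Y / T₀ ^ (1 - ε) + Real.log Y / T₀ ^ (1 - ε) + T₀ ^ ε) := by

  intro ε hε
  set f := DirichletCharacter.LFunction χ with hf
  have hdiff : Differentiable ℂ f := DirichletCharacter.differentiable_LFunction hχ
  obtain ⟨C₀, hC₀, hgrow⟩ := DirichletCharacter.exists_norm_LFunction_le hχ
  have hnz : ∀ s : ℂ, 1 / 2 < s.re → f s ≠ 0 := fun s hs ↦
    DirichletCharacter.LFunction_ne_zero_of_half_lt_re hχ hGRH hs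
  have hnear : ∀ s : ℂ, 2 < s.re → ‖f s - 1‖ ≤ 3 / 4 := fun s hs ↦
    DirichletCharacter.norm_LFunction_sub_one_le χ hs
  set η := min (ε / 5) (1 / 120) with hη
  have hη0 : 0 < η := by positivity
  have hη1 : 5 * η ≤ ε := by linarith [min_le_left (ε / 5) (1 / 120)]
  have hη2 : 5 * η ≤ 1 / 24 := by linarith [min_le_right (ε / 5) (1 / 120)]
  set Z : Set ℝ := {γ | f (1 / 2 + I * γ) = 0} with hZ
  obtain ⟨K, hK, hcount⟩ : ∃ K : ℝ, 0 < K ∧ ∀ (t : ℝ) (F : Finset ℝ),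
      (∀ γ ∈ F, γ ∈ Z ∧ |γ - t| ≤ 1 / 2) → (F.card : ℝ) ≤ K * (1 + Real.log (1 + |t|)) :=
    exists_card_zeros_le hdiff hC₀ hgrow hnear
  obtain ⟨K₁, hK₁, hderiv⟩ := exists_norm_deriv_le_rpow hdiff hC₀ hgrow hnz hnear hη0
    (by linarith)
  set a : ℝ → ℂ := fun γ ↦ deriv f (1 / 2 + I * γ) / (1 / 2 + I * γ) with ha
  have habound : ∀ γ ∈ Z, ‖a γ‖ ≤ 4 * K₁ * (1 + |γ|) ^ (-1 + η) := by
    intro γ _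
    have h1 := hderiv (1 / 2 + I * γ) (by simp)
    rw [show (1 / 2 + I * γ : ℂ).im = γ by simp] at h1
    have h0 : 0 < 1 + |γ| := by positivity
    rw [ha, norm_div]
    calc _ ≤ K₁ * (1 + |γ|) ^ η / ((1 + |γ|) / 4) := by
          gcongr
          exact one_add_abs_le_norm_half_add γ
      _ = _ := by
          rw [Real.rpow_add h0, Real.rpow_neg_one]
          field_simp
  set Φ : ℝ → ℝ → Finset ℝ := fun v w ↦
    (finite_setOf_mem_abs_le hK hcount w).toFinset.filter fun γ ↦ v < |γ| with hΦdef
  have hΦ : ∀ v w γ, γ ∈ Φ v w ↔ γ ∈ Z ∧ v < |γ| ∧ |γ| ≤ w := by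
    intro v w γ
    rw [hΦdef, Finset.mem_filter, Set.Finite.mem_toFinset, Set.mem_ofPred_eq]
    tauto
  obtain ⟨C, hC, hdom⟩ := exists_dominating_function hK (by positivity : 0 < 4 * K₁) hη0 hη2 hη1
    hcount habound hΦ
  set r := Real.exp (-(1 / 36)) with hr
  have hr1 : r < 1 := Real.exp_lt_one_iff.mpr (by norm_num)
  have hr0 : 0 < r := Real.exp_pos _
  have hr2 : 0 < 1 - r := by linarith
  refine ⟨C + 2 * C / (1 - r), by positivity, fun T₀ hT₀ T hT Y hY ↦ ?_⟩
  have hT₀0 : 0 < T₀ := by linarith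
  have hsum (y τ : ℝ) : (∑' ρ : {ρ : ℂ // f ρ = 0 ∧ 0 < ρ.re ∧ ρ.re < 1 ∧ T₀ < |ρ.im| ∧
      |ρ.im| ≤ τ}, deriv f (ρ : ℂ) * (Real.exp y : ℂ) ^ (I * (ρ : ℂ).im) /
        (1 / 2 + I * (ρ : ℂ).im)) = ∑ γ ∈ Φ T₀ τ, a γ * exp (I * y * γ) := by
    have hset : {ρ : ℂ | f ρ = 0 ∧ 0 < ρ.re ∧ ρ.re < 1 ∧ T₀ < |ρ.im| ∧ |ρ.im| ≤ τ} =
        ((Φ T₀ τ).image fun γ : ℝ ↦ (1 / 2 + I * γ : ℂ) : Finset ℂ) := by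
      ext ρ
      rw [Finset.mem_coe, Finset.mem_image, Set.mem_ofPred_eq]
      constructor
      · rintro ⟨h1, h2, h3, h4, h5⟩
        have hρ : (1 / 2 + I * ρ.im : ℂ) = ρ := by
          apply Complex.ext
          · simpa using (hGRH ρ h1 h2 h3).symm
          · simp
        exact ⟨ρ.im, (hΦ _ _ _).mpr ⟨by rw [hZ, Set.mem_ofPred_eq, hρ, h1], h4, h5⟩, hρ⟩
      · rintro ⟨γ, hγ, rfl⟩
        obtain ⟨h1, h2, h3⟩ := (hΦ _ _ _).mp hγ
        have e1 : (1 / 2 + I * γ : ℂ).re = 1 / 2 := by simp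
        have e2 : (1 / 2 + I * γ : ℂ).im = γ := by simp
        rw [e1, e2]
        exact ⟨h1, by norm_num, by norm_num, h2, h3⟩
    set g : ℂ → ℂ := fun ρ ↦ deriv f ρ * (Real.exp y : ℂ) ^ (I * ρ.im) / (1 / 2 + I * ρ.im) with hg
    change ∑' ρ : ({ρ : ℂ | f ρ = 0 ∧ 0 < ρ.re ∧ ρ.re < 1 ∧ T₀ < |ρ.im| ∧ |ρ.im| ≤ τ} : Set ℂ),
      g ρ = _
    rw [hset]
    refine (Finset.tsum_subtype' _ g).trans ?_
    rw [Finset.sum_image fun x _ z _ hxz ↦ by simpa using hxz]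
    refine Finset.sum_congr rfl fun γ _ ↦ ?_
    have e2 : (1 / 2 + I * γ : ℂ).im = γ := by simp
    rw [hg, ha]
    beta_reduce
    rw [e2, cpow_def_of_ne_zero (by exact_mod_cast (Real.exp_pos y).ne'),
      ← ofReal_log (Real.exp_pos y).le, Real.log_exp, div_mul_eq_mul_div,
      show (y : ℂ) * (I * γ) = I * y * γ by ring]
  simp only [hsum]
  have hmain := integral_le_of_dominated_on_unit_intervals
    (F := fun y ↦ ‖∑ γ ∈ Φ T₀ (T (Real.exp y)), a γ * exp (I * y * γ)‖ ^ 2)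
    (fun y ↦ by positivity) (E := C * T₀ ^ (-1 + ε)) (D := 2 * C) (by positivity) (by positivity)
    hr0.le hr1 (fun k hk ↦ ?_) hY
  · refine hmain.trans ?_
    have h1 : T₀ ^ (-1 + ε) = 1 / T₀ ^ (1 - ε) := by
      rw [show -1 + ε = -(1 - ε) by ring, Real.rpow_neg hT₀0.le, one_div]
    have h2 : 1 ≤ T₀ ^ ε := Real.one_le_rpow (by linarith) hε.le
    have h3 : 0 ≤ Y / T₀ ^ (1 - ε) := by positivity
    have h4 : 0 ≤ Real.log Y / T₀ ^ (1 - ε) :=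
      div_nonneg (Real.log_nonneg (by linarith)) (by positivity)
    have h5 : 0 ≤ 2 * C / (1 - r) := by positivity
    calc Y * (C * T₀ ^ (-1 + ε)) + 2 * C / (1 - r)
        = C * (Y / T₀ ^ (1 - ε)) + 2 * C / (1 - r) * 1 := by rw [h1]; ring
      _ ≤ (C + 2 * C / (1 - r)) * (Y / T₀ ^ (1 - ε)) + (C + 2 * C / (1 - r)) * T₀ ^ ε := by
          gcongr <;> linarith
      _ ≤ _ := by
          rw [← mul_add]
          gcongr
          linarith
  · have hk' : (2 : ℝ) ≤ k := by exact_mod_cast hk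
    set A := Real.exp (2 / 3 * k) / 2 with hA
    have hA1 : 1 ≤ A := by
      rw [hA, le_div_iff₀ (by norm_num)]
      linarith [Real.add_one_le_exp (2 / 3 * k : ℝ)]
    have hB : 2 * Real.exp (5 / 6 * (k + 1)) ≤ 30 * A ^ (5 / 4 : ℝ) := by
      have h1 : A ^ (5 / 4 : ℝ) = Real.exp (5 / 6 * k) / 2 ^ (5 / 4 : ℝ) := by
        rw [hA, Real.div_rpow (by positivity) (by norm_num), ← Real.exp_mul]
        ring_nf
      have h2 : (2 : ℝ) ^ (5 / 4 : ℝ) ≤ 4 := by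
        calc (2 : ℝ) ^ (5 / 4 : ℝ) ≤ 2 ^ (2 : ℝ) :=
              Real.rpow_le_rpow_of_exponent_le (by norm_num) (by norm_num)
          _ = 4 := by norm_num
      have h3 : Real.exp (5 / 6) ≤ 3 :=
        (Real.exp_le_exp.mpr (by norm_num)).trans (Real.exp_one_lt_d9.le.trans (by norm_num))
      rw [h1, mul_add, Real.exp_add, mul_one, ← mul_div_assoc, le_div_iff₀ (by positivity)]
      have h4 : Real.exp (5 / 6) * 2 ^ (5 / 4 : ℝ) ≤ 3 * 4 := by gcongr
      nlinarith [mul_le_mul_of_nonneg_left h4 (Real.exp_pos (5 / 6 * k)).le,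
        Real.exp_pos (5 / 6 * k)]
    have hAr : A ^ (-(1 / 24) : ℝ) ≤ 2 * r ^ k := by
      have h1 : r ^ k = Real.exp (2 / 3 * k) ^ (-(1 / 24) : ℝ) := by
        rw [hr, ← Real.exp_nat_mul, ← Real.exp_mul]
        ring_nf
      have h2 : (2 : ℝ) ^ (1 / 24 : ℝ) ≤ 2 := by
        calc (2 : ℝ) ^ (1 / 24 : ℝ) ≤ 2 ^ (1 : ℝ) :=
              Real.rpow_le_rpow_of_exponent_le (by norm_num) (by norm_num)
          _ = 2 := by norm_num
      rw [h1, hA, Real.div_rpow (by positivity) (by norm_num),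
        Real.rpow_neg (by norm_num : (0 : ℝ) ≤ 2), div_inv_eq_mul, mul_comm]
      gcongr
    obtain ⟨G, hGc, hG0, hGint, hGdom⟩ := hdom T₀ A (2 * Real.exp (5 / 6 * (k + 1))) (by linarith)
      hA1 (by positivity) hB k
    refine ⟨G, hGc, hG0, hGint.trans ?_, fun y hy1 hy2 ↦ hGdom y _ ?_ ?_⟩
    · rw [mul_add, mul_comm 2 C, mul_assoc C 2]
      gcongr
    · refine le_trans ?_ (hT (Real.exp y) (by linarith [Real.add_one_le_exp y])).1
      rw [hA, ← Real.exp_mul, mul_comm y]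
      gcongr
    · refine (hT (Real.exp y) (by linarith [Real.add_one_le_exp y])).2.trans ?_
      rw [← Real.exp_mul, mul_comm y]
      gcongr
end
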